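/- arXiv:2304.12073 — 5 statements merged into one kernel-verified Lean document; each statement's English description precedes it below -/
import Mathlib

section
/- For every complete bipartite graph K_{r_1,r_2} with r_1 ≥ r_2 ≥ 2, the game chromatic number satisfies χ_g(K_{r_1,r_2}) = 3. -/
/-- A color `c` is legal for vertex `v` in partial coloring `f` if no neighbor of `v`
is already colored with `c`. -/
def legalColor {V C : Type} (G : SimpleGraph V) (f : V → Option C) (v : V) (c : C) : Prop :=
  ∀ w, G.Adj v w → f w ≠ some c

/-- A move in the coloring game: choose an uncolored vertex and color it with a legal color. -/
def gameMove {V C : Type} [DecidableEq V] (G : SimpleGraph V) (f f' : V → Option C) : Prop :=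
  ∃ v c, f v = none ∧ legalColor G f v c ∧ f' = Function.update f v (some c)

/-- Every vertex is colored. -/
def isFull {V C : Type} (f : V → Option C) : Prop := ∀ v, (f v).isSome

/-- Some uncolored vertex has no legal color (then Bob wins). -/
def isStuck {V C : Type} (G : SimpleGraph V) (f : V → Option C) : Prop :=
  ∃ v, f v = none ∧ ∀ c, ¬ legalColor G f v c

/-- It is Alice's turn when an even number of vertices are colored
(Alice moves first, and each move colors exactly one vertex). -/
def aliceTurn {V C : Type} [Fintype V] (f : V → Option C) : Prop :=
  Even (Finset.univ.filter (fun v => (f v).isSome = true)).card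

/-- Alice has a winning strategy from position `f` when `n` vertices remain uncolored:
Alice wins exactly the plays in which the entire graph gets colored; as soon as some
uncolored vertex has no legal color, Bob wins. -/
def aliceWinsFrom {V C : Type} [Fintype V] [DecidableEq V] (G : SimpleGraph V) :
    ℕ → (V → Option C) → Prop
  | 0, f => isFull f
  | n + 1, f => isFull f ∨ (¬ isStuck G f ∧
      ((aliceTurn f ∧ ∃ f', gameMove G f f' ∧ aliceWinsFrom G n f') ∨
       (¬ aliceTurn f ∧ ∀ f', gameMove G f f' → aliceWinsFrom G n f')))

/-- Alice has a winning strategy in the graph coloring game on `G` with `m` colors. -/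
def aliceWins {V : Type} [Fintype V] [DecidableEq V] (G : SimpleGraph V) (m : ℕ) : Prop :=
  aliceWinsFrom (C := Fin m) G (Fintype.card V) (fun _ => none)

/-- The game chromatic number: the least number of colors for which Alice has
a winning strategy. -/
noncomputable def gameChromaticNumber {V : Type} [Fintype V] [DecidableEq V]
    (G : SimpleGraph V) : ℕ :=
  sInf {m | aliceWins G m}

/-- The complete multipartite graph `K_{r 0, …, r (k-1)}`. -/
def K (k : ℕ) (r : Fin k → ℕ) : SimpleGraph (Σ i : Fin k, Fin (r i)) :=
  SimpleGraph.completeMultipartiteGraph (fun i => Fin (r i))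

section ColoringGame

variable {V C : Type}

/-- No two adjacent vertices carry the same color. -/
def properPartial (G : SimpleGraph V) (f : V → Option C) : Prop :=
  ∀ v w c, G.Adj v w → f v = some c → f w ≠ some c

lemma properPartial.update [DecidableEq V] {G : SimpleGraph V} {f : V → Option C}
    (hf : properPartial G f) {v : V} {c : C} (hc : legalColor G f v c) :
    properPartial G (Function.update f v (some c)) := by
  intro a b d hab ha hb
  by_cases hav : a = v <;> by_cases hbv : b = v
  · subst hav hbv
    exact G.loopless.irrefl _ hab
  · subst hav
    rw [Function.update_self] at ha
    rw [Function.update_of_ne hbv] at hb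
    exact hc b hab (by rw [hb, ha])
  · subst hbv
    rw [Function.update_self] at hb
    rw [Function.update_of_ne hav] at ha
    exact hc a hab.symm (by rw [ha, hb])
  · rw [Function.update_of_ne hav] at ha
    rw [Function.update_of_ne hbv] at hb
    exact hf a b d hab ha hb

lemma card_colored_update [Fintype V] [DecidableEq V] {f : V → Option C} {v : V}
    (hv : f v = none) (c : C) :
    (Finset.univ.filter fun w => (Function.update f v (some c) w).isSome = true).card =
      (Finset.univ.filter fun w => (f w).isSome = true).card + 1 := by
  have h : (Finset.univ.filter fun w => (Function.update f v (some c) w).isSome = true) =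
      insert v (Finset.univ.filter fun w => (f w).isSome = true) := by
    ext w
    by_cases hw : w = v
    · simp [hw]
    · simp [hw]
  rw [h, Finset.card_insert_of_notMem (by simp [hv])]

lemma aliceTurn_update_iff [Fintype V] [DecidableEq V] {f : V → Option C} {v : V}
    (hv : f v = none) (c : C) :
    aliceTurn (Function.update f v (some c)) ↔ ¬ aliceTurn f := by
  unfold aliceTurn
  rw [card_colored_update hv, Nat.even_add_one]

lemma aliceTurn_empty [Fintype V] : aliceTurn (fun _ : V => (none : Option C)) := by
  simp [aliceTurn]

/-- In a complete bipartite graph, a properly colored position in which both sides already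
carry a color is winning for Alice. -/
lemma aliceWinsFrom_of_sides_colored [Fintype V] [DecidableEq V] {G : SimpleGraph V}
    {side : V → Fin 2} (hG : ∀ v w, G.Adj v w ↔ side v ≠ side w) (n : ℕ) :
    ∀ f : V → Option C, properPartial G f → (∀ i, ∃ w, side w = i ∧ (f w).isSome) →
      Fintype.card V ≤ (Finset.univ.filter fun v => (f v).isSome = true).card + n →
      aliceWinsFrom G n f := by
  induction n with
  | zero =>
    intro f _ _ hn v
    have h := Finset.eq_univ_of_card _ (le_antisymm (Finset.card_le_univ _) hn)
    have hv := Finset.mem_univ v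
    rw [← h] at hv
    simpa using hv
  | succ n ih =>
    intro f hf hs hn
    have hlegal : ∀ v, ∃ c, legalColor G f v c := by
      intro v
      obtain ⟨w, hw, hc⟩ := hs (side v)
      obtain ⟨c, hc⟩ := Option.isSome_iff_exists.1 hc
      refine ⟨c, fun u hu => hf w u c ?_ hc⟩
      rw [hG] at hu ⊢
      rwa [hw]
    have hstep : ∀ f', gameMove G f f' → aliceWinsFrom G n f' := by
      rintro _ ⟨v, c, hv, hc, rfl⟩
      refine ih _ (hf.update hc) (fun i => ?_) ?_
      · obtain ⟨w, hw, hwc⟩ := hs i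
        refine ⟨w, hw, ?_⟩
        by_cases h : w = v
        · simp [h]
        · simpa [h] using hwc
      · rw [card_colored_update hv]
        omega
    by_cases hfull : isFull f
    · exact Or.inl hfull
    refine Or.inr ⟨?_, ?_⟩
    · rintro ⟨v, _, hv⟩
      obtain ⟨c, hc⟩ := hlegal v
      exact hv c hc
    · by_cases ht : aliceTurn f
      · obtain ⟨v, hv⟩ := not_forall.1 hfull
        obtain ⟨c, hc⟩ := hlegal v
        have hm : gameMove G f (Function.update f v (some c)) :=
          ⟨v, c, by simpa using hv, hc, rfl⟩
        exact Or.inl ⟨ht, _, hm, hstep _ hm⟩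
      · exact Or.inr ⟨ht, hstep⟩

lemma not_isFull_of_none {f : V → Option C} {v : V} (hv : f v = none) : ¬ isFull f := by
  intro h
  simpa [hv] using h v

lemma not_aliceWinsFrom_of_isStuck [Fintype V] [DecidableEq V] {G : SimpleGraph V}
    {f : V → Option C} (hf : isStuck G f) (n : ℕ) : ¬ aliceWinsFrom G n f := by
  have hfull : ¬ isFull f := not_isFull_of_none hf.choose_spec.1
  cases n with
  | zero => exact hfull
  | succ n => exact fun h => h.elim hfull fun h => h.1 hf

/-- With three colors Alice wins on every complete bipartite graph with at least three vertices
and nonempty sides. -/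
lemma aliceWins_three [Fintype V] [DecidableEq V] {G : SimpleGraph V}
    {side : V → Fin 2} (hG : ∀ v w, G.Adj v w ↔ side v ≠ side w)
    (hside : ∀ i, ∃ v, side v = i) (hcard : 3 ≤ Fintype.card V) : aliceWins G 3 := by
  obtain ⟨n, hn⟩ := Nat.exists_eq_add_of_le' hcard
  obtain ⟨v₀, hv₀⟩ := hside 0
  obtain ⟨v₁, hv₁⟩ := hside 1
  have hne : v₁ ≠ v₀ := by
    rintro rfl
    simp [hv₀] at hv₁
  unfold aliceWins
  rw [hn]
  set f₀ : V → Option (Fin 3) := fun _ => none with hf₀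
  have hp₀ : properPartial G f₀ := by simp [properPartial, f₀]
  have hl₀ : ∀ v c, legalColor G f₀ v c := by simp [legalColor, f₀]
  set f₁ := Function.update f₀ v₀ (some 0) with hf₁
  have hp₁ : properPartial G f₁ := hp₀.update (hl₀ v₀ 0)
  have hnone : ∀ v, v ≠ v₀ → f₁ v = none := fun v hv => by simp [f₁, f₀, hv]
  have hsome : f₁ v₀ = some 0 := by simp [f₁]
  have ht₁ : ¬ aliceTurn f₁ := by
    rw [hf₁, aliceTurn_update_iff rfl, not_not]
    exact aliceTurn_empty
  have hc₁ : (Finset.univ.filter fun w => (f₁ w).isSome = true).card = 1 := by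
    rw [hf₁, card_colored_update rfl]
    simp [f₀]
  refine Or.inr ⟨?_, Or.inl ⟨aliceTurn_empty, f₁, ⟨v₀, 0, rfl, hl₀ v₀ 0, rfl⟩, ?_⟩⟩
  · rintro ⟨v, _, hv⟩
    exact hv 0 (hl₀ v 0)
  refine Or.inr ⟨?_, Or.inr ⟨ht₁, ?_⟩⟩
  · rintro ⟨v, _, hv⟩
    refine hv 1 fun w _ => ?_
    by_cases h : w = v₀
    · simp [h, hsome]
    · simp [hnone w h]
  rintro _ ⟨v, c, hv, hc, rfl⟩
  have hvv : v ≠ v₀ := by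
    rintro rfl
    simp [hsome] at hv
  have hp₂ := hp₁.update hc
  have hc₂ := card_colored_update hv c
  have ht₂ := (aliceTurn_update_iff hv c).2 ht₁
  set f₂ := Function.update f₁ v (some c) with hf₂
  have hsome₂ : f₂ v₀ = some 0 := by simp [f₂, hvv.symm, hsome]
  by_cases hs : side v = 1
  · refine aliceWinsFrom_of_sides_colored hG _ _ hp₂ (fun i => ?_) (by omega)
    fin_cases i
    · exact ⟨v₀, hv₀, by simp [hsome₂]⟩
    · exact ⟨v, hs, by simp [f₂]⟩
  · have hv₁v : v₁ ≠ v := by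
      rintro rfl
      exact hs hv₁
    have hv₁n : f₂ v₁ = none := by simp [f₂, hv₁v, hnone v₁ hne]
    obtain ⟨d, hd₀, hdc⟩ : ∃ d : Fin 3, d ≠ 0 ∧ d ≠ c :=
      (show ∀ c : Fin 3, ∃ d : Fin 3, d ≠ 0 ∧ d ≠ c by decide) c
    have hd : ∀ u, legalColor G f₂ u d := by
      intro u w _ hw
      by_cases h : w = v
      · simp only [f₂, h, Function.update_self, Option.some.injEq] at hw
        exact hdc hw.symm
      · rw [hf₂, Function.update_of_ne h] at hw
        by_cases h' : w = v₀
        · rw [h', hsome, Option.some.injEq] at hw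
          exact hd₀ hw.symm
        · simp [hnone w h'] at hw
    refine Or.inr ⟨?_, Or.inl ⟨ht₂, _, ⟨v₁, d, hv₁n, hd v₁, rfl⟩, ?_⟩⟩
    · rintro ⟨u, _, hu⟩
      exact hu d (hd u)
    refine aliceWinsFrom_of_sides_colored hG _ _ (hp₂.update (hd v₁)) (fun i => ?_) ?_
    · fin_cases i
      · exact ⟨v₀, hv₀, by simp [hne.symm, hsome₂]⟩
      · exact ⟨v₁, hv₁, by simp⟩
    · rw [card_colored_update hv₁n]
      omega

/-- With at most two colors Bob wins on every complete bipartite graph whose sides both have at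
least two vertices. -/
lemma not_aliceWins_of_lt_three [Fintype V] [DecidableEq V] {G : SimpleGraph V}
    {side : V → Fin 2} (hG : ∀ v w, G.Adj v w ↔ side v ≠ side w)
    (hside : ∀ i, ∃ v w, v ≠ w ∧ side v = i ∧ side w = i) (hcard : 2 ≤ Fintype.card V)
    {m : ℕ} (hm : m < 3) : ¬ aliceWins G m := by
  obtain ⟨n, hn⟩ := Nat.exists_eq_add_of_le' hcard
  unfold aliceWins
  rw [hn]
  have hopp : ∀ v, ∃ w, side w ≠ side v := fun v => by
    obtain ⟨w, -, -, hw, -⟩ := hside (side v + 1)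
    refine ⟨w, ?_⟩
    rw [hw]
    generalize side v = i
    decide +revert
  rintro (h | ⟨-, ⟨-, f', ⟨v, c, -, -, rfl⟩, h⟩ | ⟨h, -⟩⟩)
  · obtain ⟨v, -⟩ := hside 0
    exact not_isFull_of_none (v := v) rfl h
  · obtain ⟨u, hu⟩ := hopp v
    have huv : u ≠ v := by
      rintro rfl
      exact hu rfl
    obtain ⟨w, hwv, hw⟩ : ∃ w, w ≠ v ∧ side w = side v := by
      obtain ⟨a, b, hab, ha, hb⟩ := hside (side v)
      by_cases h : a = v
      · exact ⟨b, fun h' => hab (h.trans h'.symm), hb⟩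
      · exact ⟨a, h, ha⟩
    have huw : u ≠ w := by
      rintro rfl
      exact hu hw
    rcases h with h | ⟨hstuck, ⟨ht, -⟩ | ⟨-, h⟩⟩
    · exact not_isFull_of_none (v := u) (by simp [huv]) h
    · exact (aliceTurn_update_iff rfl c).1 ht aliceTurn_empty
    · by_cases hex : ∃ d, d ≠ c
      · obtain ⟨d, hd⟩ := hex
        refine not_aliceWinsFrom_of_isStuck ?_ n (h _ ⟨w, d, by simp [hwv], ?_, rfl⟩)
        · refine ⟨u, by simp [huv, huw], fun e he => ?_⟩
          have hev := he v ((hG _ _).2 hu)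
          have hew := he w ((hG _ _).2 (hw ▸ hu))
          simp only [Function.update_self, Function.update_of_ne hwv.symm, ne_eq,
            Option.some.injEq] at hev hew
          omega
        · intro x hx
          have hxv : x ≠ v := by
            rintro rfl
            exact (hG _ _).1 hx hw
          simp [hxv]
      · push Not at hex
        refine hstuck ⟨u, by simp [huv], fun e he => he v ((hG _ _).2 hu) ?_⟩
        simp [hex e]
  · exact h aliceTurn_empty

end ColoringGame

theorem bipartite_game_chromatic (r₁ r₂ : ℕ) (hord : r₂ ≤ r₁) (h2 : 2 ≤ r₂) :
    gameChromaticNumber (K 2 ![r₁, r₂]) = 3 := by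
  have hG : ∀ v w, (K 2 ![r₁, r₂]).Adj v w ↔ v.1 ≠ w.1 := fun _ _ => Iff.rfl
  have hr : ∀ i, 2 ≤ ![r₁, r₂] i := by
    intro i
    fin_cases i
    · exact h2.trans hord
    · exact h2
  have hside : ∀ i, ∃ v w : Σ i : Fin 2, Fin (![r₁, r₂] i), v ≠ w ∧ v.1 = i ∧ w.1 = i := by
    intro i
    have := hr i
    exact ⟨⟨i, 0, by omega⟩, ⟨i, 1, by omega⟩, by simp, rfl, rfl⟩
  have hcard : 4 ≤ Fintype.card (Σ i : Fin 2, Fin (![r₁, r₂] i)) := by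
    simp
    omega
  refine le_antisymm (Nat.sInf_le (aliceWins_three hG (fun i => ?_) (by omega))) ?_
  · obtain ⟨v, -, -, hv, -⟩ := hside i
    exact ⟨v, hv⟩
  · refine le_csInf ⟨3, aliceWins_three hG (fun i => ?_) (by omega)⟩ fun m hm => ?_
    · obtain ⟨v, -, -, hv, -⟩ := hside i
      exact ⟨v, hv⟩
    · by_contra! hlt
      exact not_aliceWins_of_lt_three hG hside (by omega) hlt hm
end

section
/- For every complete multipartite graph K_{r_1,…,r_k} (with k ≥ 1 parts), the game chromatic number satisfies χ_g(K_{r_1,…,r_k}) ≤ 2k − 1. -/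
namespace MultipartiteColoring

variable {V C : Type} [Fintype V]

/-- The uncolored vertices. -/
def uncolored (f : V → Option C) : Finset V := Finset.univ.filter fun v => (f v).isSome = false

lemma mem_uncolored {f : V → Option C} {v : V} : v ∈ uncolored f ↔ f v = none := by
  simp [uncolored]

lemma uncolored_update [DecidableEq V] {f : V → Option C} (v : V) (c : C) :
    uncolored (Function.update f v (some c)) = (uncolored f).erase v := by
  ext w
  by_cases h : w = v <;> simp [mem_uncolored, h]

lemma aliceTurn_update [DecidableEq V] {f : V → Option C} {v : V} (hv : f v = none) (c : C) :
    aliceTurn (Function.update f v (some c)) ↔ ¬ aliceTurn f := by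
  have h : (Finset.univ.filter fun w => (Function.update f v (some c) w).isSome = true) =
      insert v (Finset.univ.filter fun w => (f w).isSome = true) := by
    ext w
    by_cases h : w = v <;> simp [h]
  unfold aliceTurn
  rw [h, Finset.card_insert_of_notMem (by simp [hv]), Nat.even_add_one]

variable {k : ℕ} (p : V → Fin k)

/-- The parts without colored vertices, where `p` sends a vertex to its part. -/
def untouched (f : V → Option C) : Finset (Fin k) :=
  Finset.univ.filter fun i => ∀ v, p v = i → f v = none

variable {p}

lemma mem_untouched {f : V → Option C} {i : Fin k} :
    i ∈ untouched p f ↔ ∀ v, p v = i → f v = none := by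
  simp [untouched]

variable [DecidableEq V]

lemma untouched_update_subset (f : V → Option C) (v : V) (c : C) :
    untouched p (Function.update f v (some c)) ⊆ (untouched p f).erase (p v) := by
  intro i hi
  rw [mem_untouched] at hi
  rw [Finset.mem_erase, mem_untouched]
  have hiv : i ≠ p v := by
    rintro rfl
    simpa using hi v rfl
  refine ⟨hiv, fun w hw => ?_⟩
  have hwv : w ≠ v := by
    rintro rfl
    exact hiv hw.symm
  simpa [hwv] using hi w hw

/-- No color occurs in two distinct parts. -/
def Proper (p : V → Fin k) (f : V → Option C) : Prop :=
  ∀ v w c, f v = some c → f w = some c → p v = p w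

lemma Proper.update {G : SimpleGraph V} (hG : ∀ v w, G.Adj v w ↔ p v ≠ p w) {f : V → Option C}
    (hf : Proper p f) {v : V} {c : C} (hc : legalColor G f v c) :
    Proper p (Function.update f v (some c)) := by
  have key : ∀ w, f w = some c → p v = p w := fun w hw => by
    by_contra hne
    exact hc w ((hG v w).2 hne) hw
  intro a b d ha hb
  by_cases hav : a = v <;> by_cases hbv : b = v
  · rw [hav, hbv]
  · subst hav
    simp only [Function.update_self, Option.some.injEq] at ha
    rw [Function.update_of_ne hbv, ← ha] at hb
    exact key b hb
  · subst hbv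
    simp only [Function.update_self, Option.some.injEq] at hb
    rw [Function.update_of_ne hav, ← hb] at ha
    exact (key a ha).symm
  · rw [Function.update_of_ne hav] at ha
    rw [Function.update_of_ne hbv] at hb
    exact hf a b d ha hb

variable [Fintype C] [DecidableEq C]

/-- The colors that have not been used. -/
def unused (f : V → Option C) : Finset C := Finset.univ.filter fun c => ∀ v, f v ≠ some c

lemma mem_unused {f : V → Option C} {c : C} : c ∈ unused f ↔ ∀ v, f v ≠ some c := by
  simp [unused]

lemma card_unused_le (f : V → Option C) (v : V) (c : C) :
    (unused f).card ≤ (unused (Function.update f v (some c))).card + 1 := by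
  refine (Finset.card_le_card fun d hd => ?_).trans (Finset.card_insert_le c _)
  rw [Finset.mem_insert, mem_unused]
  by_cases hdc : d = c
  · exact Or.inl hdc
  · refine Or.inr fun w => ?_
    by_cases h : w = v
    · simpa [h] using Ne.symm hdc
    · simpa [h] using mem_unused.1 hd w

lemma not_isStuck {G : SimpleGraph V} (hG : ∀ v w, G.Adj v w ↔ p v ≠ p w) {f : V → Option C}
    (hf : Proper p f) (h : (untouched p f).Nonempty → (unused f).Nonempty) : ¬ isStuck G f := by
  rintro ⟨v, -, hstuck⟩
  by_cases hi : p v ∈ untouched p f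
  · obtain ⟨c, hc⟩ := h ⟨_, hi⟩
    exact hstuck c fun w _ => mem_unused.1 hc w
  · rw [mem_untouched] at hi
    push Not at hi
    obtain ⟨w, hw, hfw⟩ := hi
    obtain ⟨c, hc⟩ := Option.ne_none_iff_exists'.1 hfw
    refine hstuck c fun x hx hfx => (hG v x).1 hx ?_
    rw [← hw, hf w x c hc hfx]

/-- Alice wins by touching a new part with a new color as long as she can, provided that twice the
number of untouched parts is at most the number of unused colors, plus one on her own turn. -/
lemma aliceWinsFrom_of_card_le {G : SimpleGraph V} (hG : ∀ v w, G.Adj v w ↔ p v ≠ p w)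
    (hp : Function.Surjective p) (n : ℕ) (f : V → Option C) (hn : (uncolored f).card = n)
    (hf : Proper p f)
    (ha : aliceTurn f → (untouched p f).card = 0 ∨
      2 * (untouched p f).card ≤ (unused f).card + 1)
    (hb : ¬ aliceTurn f → (untouched p f).card = 0 ∨
      2 * (untouched p f).card ≤ (unused f).card) :
    aliceWinsFrom G n f := by
  induction n generalizing f with
  | zero =>
    intro v
    by_contra hv
    have : v ∈ uncolored f := mem_uncolored.2 (by simpa using hv)
    simp [Finset.card_eq_zero.1 hn] at this
  | succ n ih =>
    have hstuck : ¬ isStuck G f := by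
      refine not_isStuck hG hf fun hne => Finset.card_pos.1 ?_
      have := Finset.card_pos.2 hne
      by_cases ht : aliceTurn f
      · have := ha ht
        omega
      · have := hb ht
        omega
    have hcard : ∀ v c, f v = none →
        (uncolored (Function.update f v (some c))).card = n := fun v c hv => by
      rw [uncolored_update, Finset.card_erase_of_mem (mem_uncolored.2 hv), hn, Nat.add_sub_cancel]
    have hsub : ∀ v c, (untouched p (Function.update f v (some c))).card ≤
        (untouched p f).card := fun v c =>
      Finset.card_le_card ((untouched_update_subset f v c).trans (Finset.erase_subset _ _))
    refine Or.inr ⟨hstuck, ?_⟩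
    by_cases ht : aliceTurn f
    · refine Or.inl ⟨ht, ?_⟩
      have hta := ha ht
      rcases Finset.eq_empty_or_nonempty (untouched p f) with hu | ⟨i, hi⟩
      · obtain ⟨v, hv⟩ : (uncolored f).Nonempty := Finset.card_pos.1 (by omega)
        rw [mem_uncolored] at hv
        obtain ⟨c, hc⟩ : ∃ c, legalColor G f v c := by
          by_contra hno
          exact hstuck ⟨v, hv, not_exists.1 hno⟩
        have hz : (untouched p (Function.update f v (some c))).card = 0 := by
          have := hsub v c
          rw [hu, Finset.card_empty] at this
          omega
        exact ⟨_, ⟨v, c, hv, hc, rfl⟩, ih _ (hcard v c hv) (hf.update hG hc)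
          (fun _ => Or.inl hz) fun _ => Or.inl hz⟩
      · obtain ⟨v, rfl⟩ := hp i
        have hv : f v = none := mem_untouched.1 hi v rfl
        have hpos := Finset.card_pos.2 ⟨_, hi⟩
        obtain ⟨c, hc⟩ : (unused f).Nonempty := Finset.card_pos.1 (by omega)
        have hlegal : legalColor G f v c := fun w _ => mem_unused.1 hc w
        refine ⟨_, ⟨v, c, hv, hlegal, rfl⟩, ih _ (hcard v c hv) (hf.update hG hlegal)
          (fun h => absurd ht ((aliceTurn_update hv c).1 h)) fun _ => Or.inr ?_⟩
        have h₁ := Finset.card_le_card (untouched_update_subset (p := p) f v c)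
        rw [Finset.card_erase_of_mem hi] at h₁
        have h₂ := card_unused_le f v c
        omega
    · refine Or.inr ⟨ht, ?_⟩
      rintro _ ⟨v, c, hv, hc, rfl⟩
      refine ih _ (hcard v c hv) (hf.update hG hc) (fun _ => ?_)
        fun h => absurd ((aliceTurn_update hv c).2 ht) h
      have := hb ht
      have h₁ := hsub v c
      have h₂ := card_unused_le f v c
      omega

end MultipartiteColoring

open MultipartiteColoring in
theorem game_chromatic_le (k : ℕ) (hk : 1 ≤ k) (r : Fin k → ℕ)
    (hanti : Antitone r) (hpos : ∀ i, 1 ≤ r i) :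
    gameChromaticNumber (K k r) ≤ 2 * k - 1 := by
  refine Nat.sInf_le ?_
  refine aliceWinsFrom_of_card_le (G := K k r) (p := Sigma.fst) (fun _ _ => Iff.rfl)
    (fun i => ⟨⟨i, 0, hpos i⟩, rfl⟩) _ _ ?_ ?_ ?_ ?_
  · simp [uncolored]
  · intro v w c h
    simp at h
  · intro _
    refine Or.inr ?_
    simp only [untouched, unused, implies_true, Finset.filter_true, ne_eq, reduceCtorEq,
      not_false_eq_true, Finset.card_univ, Fintype.card_fin]
    omega
  · intro h
    exact absurd (by simp [aliceTurn]) h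
end

section
/- For every complete multipartite graph K_{r_1,…,r_k} with k ≥ 3 parts such that r_j = 3 for some j ∈ {1,…,k}, the game chromatic number satisfies χ_g(K_{r_1,…,r_k}) ≤ 2k − 2. -/
section MultipartiteGame

open Finset SimpleGraph

variable {ι C : Type} {α : ι → Type}

/-- No color occurs in two distinct parts. -/
def IsProper (f : (Σ i, α i) → Option C) : Prop :=
  ∀ v w c, f v = some c → f w = some c → v.1 = w.1

open Classical in
/-- The parts without colored vertices. -/
noncomputable def untouched [Fintype ι] (f : (Σ i, α i) → Option C) : Finset ι :=
  univ.filter fun i => ∀ x, f ⟨i, x⟩ = none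

open Classical in
/-- The colors that have not been used. -/
noncomputable def freeColors [Fintype C] (f : (Σ i, α i) → Option C) : Finset C :=
  univ.filter fun c => ∀ v, f v ≠ some c

theorem mem_untouched [Fintype ι] {f : (Σ i, α i) → Option C} {i : ι} :
    i ∈ untouched f ↔ ∀ x, f ⟨i, x⟩ = none := by
  simp [untouched]

theorem mem_freeColors [Fintype C] {f : (Σ i, α i) → Option C} {c : C} :
    c ∈ freeColors f ↔ ∀ v, f v ≠ some c := by
  simp [freeColors]

/-- The number of colored vertices. -/
def coloredCard {V : Type} [Fintype V] (f : V → Option C) : ℕ :=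
  (univ.filter fun v => (f v).isSome = true).card

theorem coloredCard_update {V : Type} [Fintype V] [DecidableEq V] {f : V → Option C} {v : V}
    (hv : f v = none) (c : C) :
    coloredCard (Function.update f v (some c)) = coloredCard f + 1 := by
  have h : (univ.filter fun w => (Function.update f v (some c) w).isSome = true)
      = insert v (univ.filter fun w => (f w).isSome = true) := by
    ext w
    by_cases hw : w = v
    · simp [hw]
    · simp [hw]
  rw [coloredCard, h, card_insert_of_notMem (by simp [hv]), coloredCard]

theorem isFull_of_card_le_coloredCard {V : Type} [Fintype V] {f : V → Option C}
    (h : Fintype.card V ≤ coloredCard f) : isFull f := by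
  have h' := (Finset.card_eq_iff_eq_univ _).1 (le_antisymm (Finset.card_le_univ _) h)
  intro v
  simpa using (Finset.ext_iff.1 h' v)

theorem aliceWinsFrom_of_isFull {V : Type} [Fintype V] [DecidableEq V] {G : SimpleGraph V}
    {f : V → Option C} (h : isFull f) (n : ℕ) : aliceWinsFrom G n f := by
  cases n with
  | zero => exact h
  | succ n => exact Or.inl h

theorem aliceWinsFrom_of_aliceTurn {V : Type} [Fintype V] [DecidableEq V] {G : SimpleGraph V}
    {f : V → Option C} {n : ℕ} (hs : ¬ isStuck G f) (ht : Even (coloredCard f)) {v : V} {c : C}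
    (hv : f v = none) (hc : legalColor G f v c)
    (h : aliceWinsFrom G n (Function.update f v (some c))) : aliceWinsFrom G (n + 1) f :=
  Or.inr ⟨hs, Or.inl ⟨ht, _, ⟨v, c, hv, hc, rfl⟩, h⟩⟩

theorem aliceWinsFrom_of_not_aliceTurn {V : Type} [Fintype V] [DecidableEq V] {G : SimpleGraph V}
    {f : V → Option C} {n : ℕ} (hs : ¬ isStuck G f) (ht : ¬ Even (coloredCard f))
    (h : ∀ v c, f v = none → legalColor G f v c →
      aliceWinsFrom G n (Function.update f v (some c))) : aliceWinsFrom G (n + 1) f := by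
  refine Or.inr ⟨hs, Or.inr ⟨ht, ?_⟩⟩
  rintro _ ⟨v, c, hv, hc, rfl⟩
  exact h v c hv hc

theorem IsProper.legalColor {f : (Σ i, α i) → Option C} (hf : IsProper f) {v w : Σ i, α i} {c : C}
    (hw : f w = some c) (hvw : v.1 = w.1) : legalColor (completeMultipartiteGraph α) f v c :=
  fun _ hu hc => hu (hvw.trans (hf _ _ _ hw hc))

theorem legalColor_of_mem_freeColors [Fintype C] {f : (Σ i, α i) → Option C} {c : C}
    (hc : c ∈ freeColors f) (G : SimpleGraph (Σ i, α i)) (v : Σ i, α i) : legalColor G f v c :=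
  fun w _ => mem_freeColors.1 hc w

theorem IsProper.not_isStuck [Fintype ι] [Fintype C] {f : (Σ i, α i) → Option C} (hf : IsProper f)
    (h : 0 < (untouched f).card → 0 < (freeColors f).card) :
    ¬ isStuck (completeMultipartiteGraph α) f := by
  rintro ⟨v, -, hv⟩
  by_cases hu : v.1 ∈ untouched f
  · obtain ⟨c, hc⟩ := card_pos.1 (h (card_pos.2 ⟨_, hu⟩))
    exact hv c (legalColor_of_mem_freeColors hc _ v)
  · have : ∃ x c, f ⟨v.1, x⟩ = some c := by
      simpa [untouched, Option.ne_none_iff_exists'] using hu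
    obtain ⟨x, c, hx⟩ := this
    exact hv c (hf.legalColor hx rfl)

variable [DecidableEq (Σ i, α i)]

theorem IsProper.update {f : (Σ i, α i) → Option C} (hf : IsProper f) {v : Σ i, α i} {c : C}
    (hc : _root_.legalColor (completeMultipartiteGraph α) f v c) :
    IsProper (Function.update f v (some c)) := by
  have key : ∀ w, f w = some c → v.1 = w.1 := fun w hw => by
    by_contra h
    exact hc w h hw
  intro u w d hu hw
  by_cases h1 : u = v <;> by_cases h2 : w = v
  · rw [h1, h2]
  · subst h1
    simp only [Function.update_self, Function.update_of_ne h2, Option.some.injEq] at hu hw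
    exact key w (hu ▸ hw)
  · subst h2
    simp only [Function.update_self, Function.update_of_ne h1, Option.some.injEq] at hu hw
    exact (key u (hw ▸ hu)).symm
  · rw [Function.update_of_ne h1] at hu
    rw [Function.update_of_ne h2] at hw
    exact hf _ _ _ hu hw

theorem card_freeColors_le_update [Fintype C] (f : (Σ i, α i) → Option C) (v : Σ i, α i) (c : C) :
    (freeColors f).card ≤ (freeColors (Function.update f v (some c))).card + 1 := by
  classical
  refine (card_le_card (t := insert c (freeColors (Function.update f v (some c)))) ?_).trans
    (card_insert_le _ _)
  intro d hd
  by_cases hdc : d = c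
  · simp [hdc]
  · refine mem_insert_of_mem (mem_freeColors.2 fun w => ?_)
    by_cases hw : w = v
    · simpa [hw] using Ne.symm hdc
    · simpa [hw] using mem_freeColors.1 hd w

theorem freeColors_subset_update [Fintype C] {f : (Σ i, α i) → Option C} {u : Σ i, α i} {c : C}
    (hu : f u = some c) (v : Σ i, α i) :
    freeColors f ⊆ freeColors (Function.update f v (some c)) := by
  intro d hd
  have hd' := mem_freeColors.1 hd
  refine mem_freeColors.2 fun w => ?_
  by_cases hw : w = v
  · have := hd' u
    rw [hu] at this
    simpa [hw] using this
  · simpa [hw] using hd' w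

theorem untouched_update_subset [Fintype ι] {f : (Σ i, α i) → Option C} {v : Σ i, α i}
    (hv : f v = none) (c : C) :
    untouched (Function.update f v (some c)) ⊆ untouched f := by
  intro i hi
  refine mem_untouched.2 fun x => ?_
  by_cases hw : (⟨i, x⟩ : Σ i, α i) = v
  · rw [hw, hv]
  · simpa [hw] using mem_untouched.1 hi x

theorem card_untouched_update_lt [Fintype ι] {f : (Σ i, α i) → Option C} {v : Σ i, α i}
    (hv : v.1 ∈ untouched f) (c : C) :
    (untouched (Function.update f v (some c))).card < (untouched f).card := by
  have hv' : f v = none := mem_untouched.1 hv v.2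
  refine card_lt_card ((ssubset_iff_of_subset (untouched_update_subset hv' c)).2 ⟨v.1, hv, ?_⟩)
  intro h
  simpa using mem_untouched.1 h v.2

/-- Alice wins by repeatedly starting an untouched part with a free color, provided that there
are enough free colors left. -/
theorem IsProper.aliceWinsFrom [Fintype ι] [Fintype C] [∀ i, Fintype (α i)] [∀ i, Nonempty (α i)]
    (n : ℕ) : ∀ f : (Σ i, α i) → Option C, IsProper f →
    Fintype.card (Σ i, α i) = coloredCard f + n →
    (untouched f).card = 0 ∨ 2 * (untouched f).card ≤ (freeColors f).card ∨
      (Even (coloredCard f) ∧ 2 * (untouched f).card ≤ (freeColors f).card + 1) →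
    aliceWinsFrom (completeMultipartiteGraph α) n f := by
  induction n with
  | zero =>
    intro f _ hn _
    exact isFull_of_card_le_coloredCard hn.le
  | succ n ih =>
    intro f hf hn h
    have hs := hf.not_isStuck (by omega)
    by_cases ht : Even (coloredCard f)
    · by_cases h0 : (untouched f).card = 0
      · by_cases hfull : isFull f
        · exact aliceWinsFrom_of_isFull hfull _
        obtain ⟨v, hv⟩ : ∃ v, f v = none := by simpa [isFull] using hfull
        obtain ⟨c, hc⟩ : ∃ c, _root_.legalColor (completeMultipartiteGraph α) f v c := by
          by_contra! hcon
          exact hs ⟨v, hv, hcon⟩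
        refine aliceWinsFrom_of_aliceTurn hs ht hv hc (ih _ (hf.update hc) ?_ (Or.inl ?_))
        · rw [coloredCard_update hv]; omega
        · have := card_le_card (untouched_update_subset hv c)
          omega
      · obtain ⟨i, hi⟩ := card_pos.1 (Nat.pos_of_ne_zero h0)
        obtain ⟨c, hc⟩ : (freeColors f).Nonempty := card_pos.1 (by omega)
        obtain ⟨x⟩ := ‹∀ i, Nonempty (α i)› i
        have hv : f ⟨i, x⟩ = none := mem_untouched.1 hi x
        have hc' := legalColor_of_mem_freeColors hc (completeMultipartiteGraph α) ⟨i, x⟩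
        refine aliceWinsFrom_of_aliceTurn hs ht hv hc' (ih _ (hf.update hc') ?_ ?_)
        · rw [coloredCard_update hv]; omega
        · have h1 := card_untouched_update_lt (v := ⟨i, x⟩) hi c
          have h2 := card_freeColors_le_update f ⟨i, x⟩ c
          omega
    · refine aliceWinsFrom_of_not_aliceTurn hs ht fun v c hv hc => ih _ (hf.update hc) ?_ ?_
      · rw [coloredCard_update hv]; omega
      · have h1 := card_le_card (untouched_update_subset hv c)
        have h2 := card_freeColors_le_update f v c
        have h3 : Even (coloredCard (Function.update f v (some c))) := by
          rw [coloredCard_update hv]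
          exact (Nat.not_even_iff_odd.1 ht).add_one
        simp only [h3, true_and]
        have : ¬ (Even (coloredCard f) ∧ 2 * (untouched f).card ≤ (freeColors f).card + 1) :=
          fun h => ht h.1
        simp only [this, or_false] at h
        omega

/-- Alice starts in the part with three vertices and, if Bob answers there, fills it up. -/
theorem aliceWinsFrom_of_card_eq_three [Fintype ι] [Fintype C] [∀ i, Fintype (α i)]
    [∀ i, Nonempty (α i)] (hι : 3 ≤ Fintype.card ι) (hC : Fintype.card C = 2 * Fintype.card ι - 2)
    {j : ι} (hj : Fintype.card (α j) = 3) :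
    aliceWinsFrom (C := C) (completeMultipartiteGraph α) (Fintype.card (Σ i, α i))
      (fun _ => none) := by
  classical
  set f₀ : (Σ i, α i) → Option C := fun _ => none with hf₀
  have p₀ : IsProper f₀ := by simp [IsProper, hf₀]
  have n₀ : coloredCard f₀ = 0 := by simp [coloredCard, hf₀]
  have u₀ : untouched f₀ = univ := by simp [untouched, hf₀]
  have c₀ : freeColors f₀ = univ := by simp [freeColors, hf₀]
  have u₀' : (untouched f₀).card = Fintype.card ι := by rw [u₀, card_univ]
  have c₀' : (freeColors f₀).card = Fintype.card C := by rw [c₀, card_univ]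
  have hcard : 3 ≤ Fintype.card (Σ i, α i) := by
    rw [← hj]
    exact Fintype.card_le_of_injective (Sigma.mk j) sigma_mk_injective
  obtain ⟨n, hn⟩ : ∃ n, Fintype.card (Σ i, α i) = n + 3 := ⟨_, (Nat.sub_add_cancel hcard).symm⟩
  obtain ⟨c⟩ : Nonempty C := Fintype.card_pos_iff.1 (by omega)
  obtain ⟨x⟩ := ‹∀ i, Nonempty (α i)› j
  rw [hn]
  have l₀ := legalColor_of_mem_freeColors (c₀ ▸ mem_univ c) (completeMultipartiteGraph α) ⟨j, x⟩
  refine aliceWinsFrom_of_aliceTurn (p₀.not_isStuck (by omega)) (by simp [n₀])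
    (v := ⟨j, x⟩) rfl l₀ ?_
  have p₁ := p₀.update l₀
  have n₁ := coloredCard_update (f := f₀) (v := ⟨j, x⟩) rfl c
  have u₁ := card_untouched_update_lt (f := f₀) (v := ⟨j, x⟩) (u₀ ▸ mem_univ j) c
  have c₁ := card_freeColors_le_update f₀ ⟨j, x⟩ c
  have e₁ : Function.update f₀ ⟨j, x⟩ (some c) ⟨j, x⟩ = some c := Function.update_self ..
  have t₁ : ∀ w, w ≠ ⟨j, x⟩ → Function.update f₀ ⟨j, x⟩ (some c) w = none := fun w hw => by
    simp [hw, hf₀]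
  generalize Function.update f₀ ⟨j, x⟩ (some c) = f₁ at *
  refine aliceWinsFrom_of_not_aliceTurn (p₁.not_isStuck (by omega)) (by simp [n₁, n₀])
    fun v d hv hd => ?_
  have p₂ := p₁.update hd
  have n₂ := coloredCard_update hv d
  have u₂ := card_le_card (untouched_update_subset hv d)
  have c₂ := card_freeColors_le_update f₁ v d
  have hvx : v ≠ ⟨j, x⟩ := by
    rintro rfl
    simp [e₁] at hv
  by_cases hvj : v.1 = j
  · obtain ⟨i, y⟩ := v
    obtain rfl : i = j := hvj
    have hyx : y ≠ x := by
      rintro rfl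
      exact hvx rfl
    obtain ⟨z, hz⟩ : ∃ z, z ∉ ({x, y} : Finset (α i)) := by
      by_contra! hcon
      have := card_le_card (fun z _ => hcon z : (univ : Finset (α i)) ⊆ {x, y})
      have := card_le_two (a := x) (b := y)
      rw [card_univ] at *
      omega
    simp only [mem_insert, mem_singleton, not_or] at hz
    have huniv : ∀ t : α i, t = x ∨ t = y ∨ t = z := by
      have h3 : ({x, y, z} : Finset (α i)).card = 3 :=
        card_eq_three.2 ⟨x, y, z, hyx.symm, Ne.symm hz.1, Ne.symm hz.2, rfl⟩
      have := (Finset.card_eq_iff_eq_univ _).1 (h3.trans hj.symm)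
      intro t
      simpa using Finset.ext_iff.1 this t
    have e₂ : Function.update f₁ ⟨i, y⟩ (some d) ⟨i, x⟩ = some c := by
      rw [Function.update_of_ne hvx.symm, e₁]
    have e₂' : Function.update f₁ ⟨i, y⟩ (some d) ⟨i, y⟩ = some d := Function.update_self ..
    have e₂'' : Function.update f₁ ⟨i, y⟩ (some d) ⟨i, z⟩ = none := by
      rw [Function.update_of_ne (by simpa using hz.2), t₁ _ (by simpa using hz.1)]
    have t₂ : ∀ w : Σ i, α i, w.1 ≠ i → Function.update f₁ ⟨i, y⟩ (some d) w = none := by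
      intro w hw
      rw [Function.update_of_ne (fun h => hw (by rw [h])), t₁ _ (fun h => hw (by rw [h]))]
    generalize Function.update f₁ ⟨i, y⟩ (some d) = f₂ at *
    have l₂ : _root_.legalColor (completeMultipartiteGraph α) f₂ ⟨i, z⟩ c :=
      p₂.legalColor e₂ rfl
    refine aliceWinsFrom_of_aliceTurn (p₂.not_isStuck (by omega))
      (by rw [n₂, n₁, n₀]; decide) e₂'' l₂ ?_
    have p₃ := p₂.update l₂
    have n₃ := coloredCard_update e₂'' c
    have u₃ := card_le_card (untouched_update_subset e₂'' c)
    have c₃ := card_le_card (freeColors_subset_update e₂ ⟨i, z⟩)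
    have e₃ : ∀ t, Function.update f₂ ⟨i, z⟩ (some c) ⟨i, t⟩ ≠ none := by
      intro t
      rcases huniv t with rfl | rfl | rfl
      · rw [Function.update_of_ne (by simpa using Ne.symm hz.1)]; simp [e₂]
      · rw [Function.update_of_ne (by simpa using Ne.symm hz.2)]; simp [e₂']
      · simp
    have t₃ : ∀ w : Σ i, α i, w.1 ≠ i → Function.update f₂ ⟨i, z⟩ (some c) w = none := by
      intro w hw
      rw [Function.update_of_ne (fun h => hw (by rw [h])), t₂ _ hw]
    generalize Function.update f₂ ⟨i, z⟩ (some c) = f₃ at *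
    cases n with
    | zero => exact isFull_of_card_le_coloredCard (by omega)
    | succ n =>
    refine aliceWinsFrom_of_not_aliceTurn (p₃.not_isStuck (by omega))
      (by rw [n₃, n₂, n₁, n₀]; decide) fun w b hw hb =>
        IsProper.aliceWinsFrom _ _ (p₃.update hb) ?_ (Or.inr (Or.inr ⟨?_, ?_⟩))
    · rw [coloredCard_update hw]; omega
    · rw [coloredCard_update hw, n₃, n₂, n₁, n₀]; decide
    · have hwi : w.1 ≠ i := by
        obtain ⟨i', t⟩ := w
        rintro rfl
        exact e₃ t hw
      have h1 := card_untouched_update_lt (f := f₃) (v := w)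
        (mem_untouched.2 fun t => t₃ ⟨w.1, t⟩ hwi) b
      have h2 := card_freeColors_le_update f₃ w b
      omega
  · refine IsProper.aliceWinsFrom _ _ p₂ (by omega) (Or.inr (Or.inr ⟨?_, ?_⟩))
    · rw [n₂, n₁, n₀]; decide
    · have h1 := card_untouched_update_lt (f := f₁) (v := v)
        (mem_untouched.2 fun t => t₁ ⟨v.1, t⟩ fun h => hvj (congrArg Sigma.fst h)) d
      omega

end MultipartiteGame

theorem game_chromatic_le_of_part_three (k : ℕ) (hk : 3 ≤ k) (r : Fin k → ℕ)
    (hanti : Antitone r) (hpos : ∀ i, 1 ≤ r i) (h3 : ∃ j, r j = 3) :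
    gameChromaticNumber (K k r) ≤ 2 * k - 2 := by
  obtain ⟨j, hj⟩ := h3
  have : ∀ i, Nonempty (Fin (r i)) := fun i => ⟨⟨0, hpos i⟩⟩
  exact Nat.sInf_le (aliceWinsFrom_of_card_eq_three (C := Fin (2 * k - 2)) (by simpa using hk)
    (by simp) (j := j) (by simpa using hj))
end

section
/- For every complete multipartite graph K_{r_1,…,r_k} with k ≥ 3 parts such that every part size satisfies r_j ≥ 2 and r_j ≠ 3, the game chromatic number satisfies χ_g(K_{r_1,…,r_k}) ≥ min{2k − 1, Σ_{i=1}^{k} ⌈r_i/2⌉}. -/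
/-! ### Enough colors always suffice -/

section General

variable {V C : Type} [Fintype V] {G : SimpleGraph V}

/-- The colors that appear in a partial coloring. -/
def usedColors [DecidableEq C] (f : V → Option C) : Finset C :=
  (Finset.univ.image f).eraseNone

theorem mem_usedColors [DecidableEq C] {f : V → Option C} {c : C} :
    c ∈ usedColors f ↔ ∃ v, f v = some c := by
  simp [usedColors, Finset.mem_eraseNone]

theorem usedColors_update [DecidableEq V] [DecidableEq C] {f : V → Option C} {v : V} (hv : f v = none) (c : C) :
    usedColors (Function.update f v (some c)) = insert c (usedColors f) := by
  ext d
  simp only [mem_usedColors, Finset.mem_insert]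
  constructor
  · rintro ⟨w, hw⟩
    by_cases h : w = v
    · subst h
      left
      simpa using hw.symm
    · right
      exact ⟨w, by simpa [h] using hw⟩
  · rintro (rfl | ⟨w, hw⟩)
    · exact ⟨v, by simp⟩
    · refine ⟨w, ?_⟩
      have h : w ≠ v := by
        rintro rfl
        simp [hv] at hw
      simpa [h] using hw

theorem legalColor_of_notMem_usedColors [DecidableEq C] {f : V → Option C} {c : C}
    (hc : c ∉ usedColors f) (v : V) : legalColor G f v c :=
  fun w _ hw => hc (mem_usedColors.2 ⟨w, hw⟩)

theorem filter_isSome_update [DecidableEq V] {f : V → Option C} {v : V} (c : C) :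
    Finset.univ.filter (fun w => (Function.update f v (some c) w).isSome = true) =
      insert v (Finset.univ.filter (fun w => (f w).isSome = true)) := by
  ext w
  by_cases h : w = v
  · subst h
    simp
  · simp [h]

theorem card_filter_isSome_update [DecidableEq V] {f : V → Option C} {v : V} (hv : f v = none) (c : C) :
    (Finset.univ.filter (fun w => (Function.update f v (some c) w).isSome = true)).card =
      (Finset.univ.filter (fun w => (f w).isSome = true)).card + 1 := by
  rw [filter_isSome_update, Finset.card_insert_of_notMem (by simp [hv])]

theorem aliceTurn_update [DecidableEq V] {f : V → Option C} {v : V} (hv : f v = none) (c : C) :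
    aliceTurn (Function.update f v (some c)) ↔ ¬ aliceTurn f := by
  unfold aliceTurn
  rw [card_filter_isSome_update hv, Nat.even_add_one]

theorem card_usedColors_le [DecidableEq C] (f : V → Option C) :
    (usedColors f).card ≤ (Finset.univ.filter (fun w => (f w).isSome = true)).card := by
  rw [← Finset.card_map Function.Embedding.some]
  refine (Finset.card_le_card ?_).trans
    (Finset.card_image_le (s := Finset.univ.filter (fun w => (f w).isSome = true)) (f := f))
  intro x hx
  obtain ⟨c, hc, rfl⟩ := Finset.mem_map.1 hx
  obtain ⟨v, hv⟩ := mem_usedColors.1 hc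
  exact Finset.mem_image.2 ⟨v, by simp [hv], hv⟩

theorem exists_legalColor_of_card_le [Fintype C] (hC : Fintype.card V ≤ Fintype.card C)
    {f : V → Option C} {v : V} (hv : f v = none) : ∃ c, legalColor G f v c := by
  classical
  have hlt : (Finset.univ.filter (fun w => (f w).isSome = true)).card < Fintype.card V := by
    rw [← Finset.card_univ]
    exact Finset.card_lt_card (Finset.filter_ssubset.2 ⟨v, Finset.mem_univ v, by simp [hv]⟩)
  obtain ⟨c, -, hc⟩ := Finset.exists_mem_notMem_of_card_lt_card
    (s := usedColors f) (t := Finset.univ)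
    (by rw [Finset.card_univ]; exact (card_usedColors_le f).trans_lt (hlt.trans_le hC))
  exact ⟨c, legalColor_of_notMem_usedColors hc v⟩

theorem aliceWinsFrom_of_card_le [DecidableEq V] [Fintype C] (hC : Fintype.card V ≤ Fintype.card C) (n : ℕ)
    (f : V → Option C)
    (hn : Fintype.card V ≤ n + (Finset.univ.filter (fun w => (f w).isSome = true)).card) :
    aliceWinsFrom G n f := by
  induction n generalizing f with
  | zero =>
    have h : Finset.univ.filter (fun w => (f w).isSome = true) = Finset.univ :=
      Finset.eq_univ_of_card _ (le_antisymm (Finset.card_le_univ _) (by omega))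
    intro v
    simpa using h.ge (Finset.mem_univ v)
  | succ n ih =>
    have step : ∀ f', gameMove G f f' → aliceWinsFrom G n f' := by
      rintro _ ⟨v, c, hv, -, rfl⟩
      apply ih
      rw [card_filter_isSome_update hv]
      omega
    by_cases hf : isFull f
    · exact Or.inl hf
    refine Or.inr ⟨?_, ?_⟩
    · rintro ⟨v, hv, hs⟩
      obtain ⟨c, hc⟩ := exists_legalColor_of_card_le (G := G) hC hv
      exact hs c hc
    · by_cases ht : aliceTurn f
      · obtain ⟨v, hv⟩ := not_forall.1 hf
        have hv : f v = none := by simpa using hv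
        obtain ⟨c, hc⟩ := exists_legalColor_of_card_le (G := G) hC hv
        exact Or.inl ⟨ht, _, ⟨v, c, hv, hc, rfl⟩, step _ ⟨v, c, hv, hc, rfl⟩⟩
      · exact Or.inr ⟨ht, step⟩

theorem aliceWins_card [DecidableEq V] : aliceWins G (Fintype.card V) :=
  aliceWinsFrom_of_card_le (by simp) _ _ (by omega)

end General

/-! ### Lower bounds for the number of colors still to be used

A part is *open* when it contains a colored vertex. Here `F` is the number of uncolored vertices
in open parts, `u` is the number of parts that are not open, and `T` is the sum of `⌈r/2⌉` over
the sizes `r` of these parts. -/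

/-- The number of new colors Bob can force before all parts are open, with Alice to move. -/
def aliceBound (F u T : ℕ) : ℕ :=
  min (if F = 1 then (if u ≤ 1 then u else 2 * u - 2) else 2 * u - 1) (F / 2 + T)

/-- The number of new colors Bob can force before all parts are open, with Bob to move. -/
def bobBound (F u T : ℕ) : ℕ :=
  if F = 0 then aliceBound 1 u T else 1 + aliceBound (F - 1) u T

theorem aliceBound_le_two_mul_sub_one {F u T : ℕ} : aliceBound F u T ≤ 2 * u - 1 := by
  unfold aliceBound
  split_ifs <;> omega

theorem aliceBound_succ_le_bobBound {F u T : ℕ} (hu : 1 ≤ u) :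
    aliceBound (F + 1) u T ≤ bobBound F u T := by
  unfold bobBound aliceBound
  split_ifs <;> omega

theorem aliceBound_le_bobBound_of_open {F F' u T T' s : ℕ} (hu : 1 ≤ u) (h2 : 2 ≤ s) (h3 : s ≠ 3)
    (hF : F' + 1 = F + s) (hT : T = T' + (s + 1) / 2) :
    aliceBound F (u + 1) T ≤ 1 + bobBound F' u T' := by
  unfold bobBound aliceBound
  split_ifs <;> omega

theorem aliceBound_one_le_of_open {F u T T' s : ℕ} (hu : 1 ≤ u)
    (hs : 4 ≤ s ∨ s = 2 ∧ T = u + 1)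
    (hF : F + 1 = s) (hT : T = T' + (s + 1) / 2) :
    aliceBound 1 (u + 1) T ≤ 1 + aliceBound F u T' := by
  unfold aliceBound
  split_ifs <;> omega

/-! ### Positions on complete multipartite graphs -/

section Multipartite

variable {k : ℕ} {r : Fin k → ℕ} {C : Type}

/-- The parts without a colored vertex. -/
def closedParts (f : (Σ i : Fin k, Fin (r i)) → Option C) : Finset (Fin k) :=
  Finset.univ.filter (fun i => ∀ x, (f ⟨i, x⟩).isSome = false)

/-- The uncolored vertices in parts that contain a colored vertex. -/
def openFree (f : (Σ i : Fin k, Fin (r i)) → Option C) : Finset (Σ i : Fin k, Fin (r i)) :=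
  Finset.univ.filter (fun v => (f v).isSome = false ∧ v.1 ∉ closedParts f)

theorem mem_closedParts {f : (Σ i : Fin k, Fin (r i)) → Option C} {i : Fin k} :
    i ∈ closedParts f ↔ ∀ x, f ⟨i, x⟩ = none := by
  simp [closedParts]

theorem mem_openFree {f : (Σ i : Fin k, Fin (r i)) → Option C} {v : Σ i : Fin k, Fin (r i)} :
    v ∈ openFree f ↔ f v = none ∧ v.1 ∉ closedParts f := by
  simp [openFree]

theorem closedParts_update (f : (Σ i : Fin k, Fin (r i)) → Option C) (v : Σ i : Fin k, Fin (r i))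
    (c : C) : closedParts (Function.update f v (some c)) = (closedParts f).erase v.1 := by
  obtain ⟨j, y⟩ := v
  ext i
  simp only [mem_closedParts, Finset.mem_erase]
  constructor
  · intro h
    have hij : i ≠ j := by
      rintro rfl
      simpa using h y
    refine ⟨hij, fun x => ?_⟩
    have hne : (⟨i, x⟩ : Σ i : Fin k, Fin (r i)) ≠ ⟨j, y⟩ := fun e => hij (congrArg Sigma.fst e)
    simpa [Function.update_of_ne hne] using h x
  · rintro ⟨hij, h⟩ x
    have hne : (⟨i, x⟩ : Σ i : Fin k, Fin (r i)) ≠ ⟨j, y⟩ := fun e => hij (congrArg Sigma.fst e)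
    rw [Function.update_of_ne hne]
    exact h x

theorem closedParts_update_of_notMem {f : (Σ i : Fin k, Fin (r i)) → Option C}
    {v : Σ i : Fin k, Fin (r i)} (hv : v.1 ∉ closedParts f) (c : C) :
    closedParts (Function.update f v (some c)) = closedParts f := by
  rw [closedParts_update, Finset.erase_eq_of_notMem hv]

theorem card_openFree_update_of_notMem {f : (Σ i : Fin k, Fin (r i)) → Option C}
    {v : Σ i : Fin k, Fin (r i)} (hf : f v = none) (hv : v.1 ∉ closedParts f) (c : C) :
    (openFree (Function.update f v (some c))).card + 1 = (openFree f).card := by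
  have h : openFree (Function.update f v (some c)) = (openFree f).erase v := by
    ext w
    rw [mem_openFree, Finset.mem_erase, mem_openFree, closedParts_update_of_notMem hv]
    by_cases hw : w = v
    · subst hw
      simp
    · simp [hw]
  rw [h, Finset.card_erase_add_one (mem_openFree.2 ⟨hf, hv⟩)]

theorem card_openFree_update_of_mem {f : (Σ i : Fin k, Fin (r i)) → Option C}
    {v : Σ i : Fin k, Fin (r i)} (hv : v.1 ∈ closedParts f) (c : C) :
    (openFree (Function.update f v (some c))).card + 1 = (openFree f).card + r v.1 := by
  have hf := mem_closedParts.1 hv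
  set P : Finset (Σ i : Fin k, Fin (r i)) :=
    Finset.univ.map (Function.Embedding.sigmaMk (β := fun i => Fin (r i)) v.1) with hP
  have memP : ∀ w, w ∈ P ↔ w.1 = v.1 := by
    rintro ⟨i, x⟩
    simp only [hP, Finset.mem_map, Finset.mem_univ, true_and, Function.Embedding.sigmaMk_apply]
    constructor
    · rintro ⟨y, hy⟩
      exact (congrArg Sigma.fst hy).symm
    · intro h
      subst h
      exact ⟨x, rfl⟩
  have h : openFree (Function.update f v (some c)) = (openFree f ∪ P).erase v := by
    ext w
    rw [mem_openFree, Finset.mem_erase, Finset.mem_union, mem_openFree, memP, closedParts_update,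
      Finset.mem_erase]
    by_cases hw : w = v
    · subst hw
      simp
    · by_cases hw' : w.1 = v.1
      · obtain ⟨i, x⟩ := w
        dsimp only at hw'
        subst hw'
        simp [hw, hf x]
      · simp [hw, hw']
  have hdisj : Disjoint (openFree f) P := by
    rw [Finset.disjoint_left]
    intro w hw hwP
    exact (mem_openFree.1 hw).2 (by rwa [(memP w).1 hwP])
  rw [h, Finset.card_erase_add_one (Finset.mem_union_right _ ((memP v).2 rfl)),
    Finset.card_union_of_disjoint hdisj, hP, Finset.card_map, Finset.card_univ, Fintype.card_fin]

theorem notMem_usedColors_of_legalColor [DecidableEq C]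
    {f : (Σ i : Fin k, Fin (r i)) → Option C} {v : Σ i : Fin k, Fin (r i)}
    (hv : v.1 ∈ closedParts f) {c : C} (hc : legalColor (K k r) f v c) :
    c ∉ usedColors f := by
  intro h
  obtain ⟨w, hw⟩ := mem_usedColors.1 h
  refine hc w ?_ hw
  change v.1 ≠ w.1
  intro e
  obtain ⟨i, x⟩ := w
  dsimp only at e
  subst e
  simp [mem_closedParts.1 hv x] at hw

/-- The sum of `⌈r i / 2⌉` over the parts without a colored vertex. -/
def closedWeight (f : (Σ i : Fin k, Fin (r i)) → Option C) : ℕ :=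
  ∑ i ∈ closedParts f, (r i + 1) / 2

theorem closedWeight_update_of_mem {f : (Σ i : Fin k, Fin (r i)) → Option C}
    {v : Σ i : Fin k, Fin (r i)} (hv : v.1 ∈ closedParts f) (c : C) :
    closedWeight f = closedWeight (Function.update f v (some c)) + (r v.1 + 1) / 2 := by
  unfold closedWeight
  rw [closedParts_update, Finset.sum_erase_add _ _ hv]

theorem closedWeight_update_of_notMem {f : (Σ i : Fin k, Fin (r i)) → Option C}
    {v : Σ i : Fin k, Fin (r i)} (hv : v.1 ∉ closedParts f) (c : C) :
    closedWeight (Function.update f v (some c)) = closedWeight f := by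
  unfold closedWeight
  rw [closedParts_update_of_notMem hv]

theorem card_closedParts_update_of_mem {f : (Σ i : Fin k, Fin (r i)) → Option C}
    {v : Σ i : Fin k, Fin (r i)} (hv : v.1 ∈ closedParts f) (c : C) :
    (closedParts f).card = (closedParts (Function.update f v (some c))).card + 1 := by
  rw [closedParts_update, Finset.card_erase_add_one hv]

theorem exists_mem_closedParts_four_le_or {f : (Σ i : Fin k, Fin (r i)) → Option C}
    (h2 : ∀ j, 2 ≤ r j) (hne3 : ∀ j, r j ≠ 3) (hf : (closedParts f).Nonempty) :
    ∃ i ∈ closedParts f, 4 ≤ r i ∨ r i = 2 ∧ closedWeight f = (closedParts f).card := by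
  by_cases h : ∃ i ∈ closedParts f, 4 ≤ r i
  · obtain ⟨i, hi, h⟩ := h
    exact ⟨i, hi, Or.inl h⟩
  · push Not at h
    have htwo : ∀ i ∈ closedParts f, r i = 2 := fun i hi => by
      have h1 := h i hi
      have h2 := h2 i
      have h3 := hne3 i
      omega
    obtain ⟨i, hi⟩ := hf
    refine ⟨i, hi, Or.inr ⟨htwo i hi, ?_⟩⟩
    rw [closedWeight, Finset.card_eq_sum_ones]
    exact Finset.sum_congr rfl fun j hj => by rw [htwo j hj]

/-! ### Bob's strategy -/

/-- A position that Bob wins by always using a new color, in an open part if possible. -/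
def BobGood {m : ℕ} (f : (Σ i : Fin k, Fin (r i)) → Option (Fin m)) : Prop :=
  (closedParts f).Nonempty ∧
    (aliceTurn f → m < (usedColors f).card +
      aliceBound (openFree f).card (closedParts f).card (closedWeight f)) ∧
    (¬ aliceTurn f → m < (usedColors f).card +
      bobBound (openFree f).card (closedParts f).card (closedWeight f))

theorem BobGood.of_alice_move {m : ℕ} {f f' : (Σ i : Fin k, Fin (r i)) → Option (Fin m)}
    (h2 : ∀ j, 2 ≤ r j) (hne3 : ∀ j, r j ≠ 3) (hf : BobGood f) (ht : aliceTurn f)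
    (hmove : gameMove (K k r) f f') : BobGood f' := by
  obtain ⟨v, c, hv, hc, rfl⟩ := hmove
  obtain ⟨hne, hA, -⟩ := hf
  have hA := hA ht
  have ht' : ¬ aliceTurn (Function.update f v (some c)) := by
    rw [aliceTurn_update hv]
    exact not_not.2 ht
  have hm : (usedColors (Function.update f v (some c))).card ≤ m := by
    simpa using Finset.card_le_univ (usedColors (Function.update f v (some c)))
  by_cases hmem : v.1 ∈ closedParts f
  · have hcol := notMem_usedColors_of_legalColor hmem hc
    rw [usedColors_update hv, Finset.card_insert_of_notMem hcol] at hm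
    have hu := card_closedParts_update_of_mem hmem c
    have hle := aliceBound_le_two_mul_sub_one (F := (openFree f).card)
      (u := (closedParts f).card) (T := closedWeight f)
    have hpos : 1 ≤ (closedParts (Function.update f v (some c))).card := by omega
    refine ⟨Finset.card_pos.1 hpos, fun h => absurd h ht', fun _ => ?_⟩
    have := aliceBound_le_bobBound_of_open hpos (h2 v.1) (hne3 v.1)
      (card_openFree_update_of_mem hmem c) (closedWeight_update_of_mem hmem c)
    rw [← hu] at this
    rw [usedColors_update hv, Finset.card_insert_of_notMem hcol]
    omega
  · rw [← card_openFree_update_of_notMem hv hmem c] at hA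
    refine ⟨by rwa [closedParts_update_of_notMem hmem], fun h => absurd h ht', fun _ => ?_⟩
    rw [closedParts_update_of_notMem hmem, closedWeight_update_of_notMem hmem,
      usedColors_update hv]
    have := aliceBound_succ_le_bobBound (F := (openFree (Function.update f v (some c))).card)
      (T := closedWeight f) hne.card_pos
    have := Finset.card_le_card (Finset.subset_insert c (usedColors f))
    omega

theorem BobGood.exists_bob_move {m : ℕ} {f : (Σ i : Fin k, Fin (r i)) → Option (Fin m)}
    (h2 : ∀ j, 2 ≤ r j) (hne3 : ∀ j, r j ≠ 3) (hf : BobGood f) (ht : ¬ aliceTurn f)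
    (hs : ¬ isStuck (K k r) f) : ∃ f', gameMove (K k r) f f' ∧ BobGood f' := by
  obtain ⟨hne, -, hB⟩ := hf
  have hB := hB ht
  obtain ⟨c, hc⟩ : ∃ c, c ∉ usedColors f := by
    by_contra! hall
    obtain ⟨i, hi⟩ := hne
    refine hs ⟨⟨i, ⟨0, by have := h2 i; omega⟩⟩, mem_closedParts.1 hi _, fun c hc => ?_⟩
    exact notMem_usedColors_of_legalColor hi hc (hall c)
  have hm : (insert c (usedColors f)).card ≤ m := by
    simpa using Finset.card_le_univ (insert c (usedColors f))
  rw [Finset.card_insert_of_notMem hc] at hm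
  rcases (openFree f).eq_empty_or_nonempty with hF | ⟨v, hvF⟩
  · obtain ⟨i, hi, hri⟩ := exists_mem_closedParts_four_le_or h2 hne3 hne
    let v : Σ i : Fin k, Fin (r i) := ⟨i, ⟨0, by have := h2 i; omega⟩⟩
    have hmem : v.1 ∈ closedParts f := hi
    have hv : f v = none := mem_closedParts.1 hi _
    have ht' : aliceTurn (Function.update f v (some c)) := (aliceTurn_update hv c).2 ht
    have hcard := card_openFree_update_of_mem hmem c
    have hu := card_closedParts_update_of_mem hmem c
    rw [hF, Finset.card_empty, bobBound, if_pos rfl] at hB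
    have hpos : 1 ≤ (closedParts (Function.update f v (some c))).card := by
      by_contra! h0
      have h1 : (closedParts f).card = 1 := by omega
      rw [h1, aliceBound] at hB
      simp only [if_true, le_refl] at hB
      omega
    refine ⟨_, ⟨v, c, hv, legalColor_of_notMem_usedColors hc v, rfl⟩, Finset.card_pos.1 hpos,
      fun _ => ?_, fun h => absurd ht' h⟩
    rw [hF, Finset.card_empty, zero_add] at hcard
    rw [hu] at hri
    have := aliceBound_one_le_of_open hpos hri hcard (closedWeight_update_of_mem hmem c)
    rw [← hu] at this
    rw [usedColors_update hv, Finset.card_insert_of_notMem hc]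
    omega
  · obtain ⟨hv, hmem⟩ := mem_openFree.1 hvF
    have ht' : aliceTurn (Function.update f v (some c)) := (aliceTurn_update hv c).2 ht
    refine ⟨_, ⟨v, c, hv, legalColor_of_notMem_usedColors hc v, rfl⟩,
      by rwa [closedParts_update_of_notMem hmem], fun _ => ?_, fun h => absurd ht' h⟩
    rw [closedParts_update_of_notMem hmem, closedWeight_update_of_notMem hmem,
      usedColors_update hv, Finset.card_insert_of_notMem hc]
    rw [← card_openFree_update_of_notMem hv hmem c, bobBound, if_neg (Nat.succ_ne_zero _),
      Nat.add_sub_cancel] at hB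
    omega

theorem BobGood.not_isFull {m : ℕ} (h2 : ∀ j, 2 ≤ r j)
    {f : (Σ i : Fin k, Fin (r i)) → Option (Fin m)} (hf : BobGood f) : ¬ isFull f := by
  obtain ⟨i, hi⟩ := hf.1
  intro h
  have hsome := h ⟨i, ⟨0, by have := h2 i; omega⟩⟩
  simp [mem_closedParts.1 hi _] at hsome

theorem BobGood.not_aliceWinsFrom {m : ℕ} (h2 : ∀ j, 2 ≤ r j) (hne3 : ∀ j, r j ≠ 3) (n : ℕ)
    {f : (Σ i : Fin k, Fin (r i)) → Option (Fin m)} (hf : BobGood f) :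
    ¬ aliceWinsFrom (K k r) n f := by
  induction n generalizing f with
  | zero => exact hf.not_isFull h2
  | succ n ih =>
    rintro (h | ⟨hs, ⟨ht, f', hmove, hwin⟩ | ⟨ht, hall⟩⟩)
    · exact hf.not_isFull h2 h
    · exact ih (hf.of_alice_move h2 hne3 ht hmove) hwin
    · obtain ⟨f', hmove, hf'⟩ := hf.exists_bob_move h2 hne3 ht hs
      exact ih hf' (hall f' hmove)

theorem bobGood_empty {m : ℕ} (hm : m < min (2 * k - 1) (∑ i, (r i + 1) / 2)) :
    BobGood (fun _ : Σ i : Fin k, Fin (r i) => (none : Option (Fin m))) := by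
  have hclosed : closedParts (fun _ : Σ i : Fin k, Fin (r i) => (none : Option (Fin m))) =
      Finset.univ := by
    ext i
    simp [mem_closedParts]
  have hfree : openFree (fun _ : Σ i : Fin k, Fin (r i) => (none : Option (Fin m))) = ∅ := by
    ext v
    simp [mem_openFree, hclosed]
  have hturn : aliceTurn (fun _ : Σ i : Fin k, Fin (r i) => (none : Option (Fin m))) := by
    simp [aliceTurn]
  refine ⟨?_, fun _ => ?_, fun h => absurd hturn h⟩
  · rw [hclosed, ← Finset.card_pos, Finset.card_univ, Fintype.card_fin]
    omega
  · rw [closedWeight, hclosed, hfree, aliceBound, Finset.card_empty, Finset.card_univ,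
      Fintype.card_fin]
    simp only [zero_ne_one, if_false, Nat.zero_div, zero_add]
    omega

end Multipartite

theorem game_chromatic_ge_of_no_three (k : ℕ) (hk : 3 ≤ k) (r : Fin k → ℕ)
    (hanti : Antitone r) (h2 : ∀ j, 2 ≤ r j) (hne3 : ∀ j, r j ≠ 3) :
    min (2 * k - 1) (∑ i, (r i + 1) / 2) ≤ gameChromaticNumber (K k r) := by
  refine le_csInf ⟨_, aliceWins_card⟩ fun m hm => ?_
  by_contra! hlt
  exact (bobGood_empty hlt).not_aliceWinsFrom h2 hne3 _ hm
end

section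
/- Let K_{r_1,…,r_k} be a complete multipartite graph with k ≥ 3 parts, smallest part of size r_k = 2, some part of size exactly 3 (r_j = 3 for some j), and an even total number of vertices n = r_1 + … + r_k. Then the game chromatic number satisfies χ_g(K_{r_1,…,r_k}) = 2k − 2. -/
namespace ColoringGame

variable {k m : ℕ} {r : Fin k → ℕ}

/-- Parts without a colored vertex. -/
noncomputable def untouched (f : (Σ i : Fin k, Fin (r i)) → Option (Fin m)) : Finset (Fin k) :=
  open Classical in Finset.univ.filter fun i => ∀ x, f ⟨i, x⟩ = none

/-- Colors that have not been used. -/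
noncomputable def freeColors (f : (Σ i : Fin k, Fin (r i)) → Option (Fin m)) : Finset (Fin m) :=
  open Classical in Finset.univ.filter fun a => ∀ v, f v ≠ some a

/-- Uncolored vertices. -/
noncomputable def uncolored (f : (Σ i : Fin k, Fin (r i)) → Option (Fin m)) :
    Finset (Σ i : Fin k, Fin (r i)) :=
  open Classical in Finset.univ.filter fun v => f v = none

/-- Uncolored vertices in parts that already have a colored vertex. -/
noncomputable def pending (f : (Σ i : Fin k, Fin (r i)) → Option (Fin m)) :
    Finset (Σ i : Fin k, Fin (r i)) :=
  open Classical in (uncolored f).filter fun v => v.1 ∉ untouched f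

/-- No two adjacent vertices share a color. -/
def IsProper (f : (Σ i : Fin k, Fin (r i)) → Option (Fin m)) : Prop :=
  ∀ v w a, f v = some a → f w = some a → v.1 = w.1

variable {f f' : (Σ i : Fin k, Fin (r i)) → Option (Fin m)}

lemma mem_untouched {i : Fin k} : i ∈ untouched f ↔ ∀ x, f ⟨i, x⟩ = none := by
  simp [untouched]

lemma mem_freeColors {a : Fin m} : a ∈ freeColors f ↔ ∀ v, f v ≠ some a := by
  simp [freeColors]

lemma mem_uncolored {v : Σ i : Fin k, Fin (r i)} : v ∈ uncolored f ↔ f v = none := by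
  simp [uncolored]

lemma mem_pending {v : Σ i : Fin k, Fin (r i)} :
    v ∈ pending f ↔ f v = none ∧ v.1 ∉ untouched f := by
  simp [pending, mem_uncolored]

lemma card_pending_add_sum : (pending f).card + ∑ i ∈ untouched f, r i = (uncolored f).card := by
  classical
  have h : (uncolored f).filter (fun v => ¬ v.1 ∉ untouched f)
      = (untouched f).sigma fun _ => Finset.univ := by
    ext ⟨i, x⟩
    simp only [Finset.mem_filter, mem_uncolored, not_not, Finset.mem_sigma, Finset.mem_univ,
      and_true, and_iff_right_iff_imp]
    exact fun h => mem_untouched.1 h x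
  have h2 := Finset.card_filter_add_card_filter_not (s := uncolored f) (fun v => v.1 ∉ untouched f)
  rw [h, Finset.card_sigma] at h2
  simp only [Finset.card_univ, Fintype.card_fin] at h2
  rw [← h2, pending]

lemma adj_iff {v w : Σ i : Fin k, Fin (r i)} : (K k r).Adj v w ↔ v.1 ≠ w.1 := Iff.rfl

lemma legalColor_iff {v : Σ i : Fin k, Fin (r i)} {a : Fin m} :
    legalColor (K k r) f v a ↔ ∀ w, f w = some a → v.1 = w.1 := by
  simp only [legalColor, adj_iff]
  exact forall_congr' fun w => by tauto

lemma legalColor_of_mem_freeColors {v : Σ i : Fin k, Fin (r i)} {a : Fin m}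
    (h : a ∈ freeColors f) : legalColor (K k r) f v a :=
  legalColor_iff.2 fun w hw => absurd hw (mem_freeColors.1 h w)

lemma mem_freeColors_of_legalColor {v : Σ i : Fin k, Fin (r i)} {a : Fin m}
    (hv : v.1 ∈ untouched f) (h : legalColor (K k r) f v a) : a ∈ freeColors f := by
  rw [mem_freeColors]
  rintro ⟨i, x⟩ hw
  have := legalColor_iff.1 h _ hw
  subst this
  simp [mem_untouched.1 hv x] at hw

section Update

variable {v : Σ i : Fin k, Fin (r i)} {a : Fin m}

lemma untouched_update :
    untouched (Function.update f v (some a)) = (untouched f).erase v.1 := by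
  ext i
  rw [Finset.mem_erase, mem_untouched, mem_untouched]
  obtain ⟨j, y⟩ := v
  constructor
  · intro h
    have hij : i ≠ j := by
      rintro rfl
      simpa using h y
    exact ⟨hij, fun x => by simpa [Function.update_apply, hij] using h x⟩
  · rintro ⟨hij, h⟩ x
    simpa [Function.update_apply, hij] using h x

lemma uncolored_update :
    uncolored (Function.update f v (some a)) = (uncolored f).erase v := by
  ext w
  rw [Finset.mem_erase, mem_uncolored, mem_uncolored, Function.update_apply]
  split_ifs with h <;> simp [h]

lemma freeColors_update (hv : f v = none) :
    freeColors (Function.update f v (some a)) = (freeColors f).erase a := by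
  ext b
  rw [Finset.mem_erase, mem_freeColors, mem_freeColors]
  constructor
  · intro h
    refine ⟨fun hb => h v (by simp [hb]), fun w hw => ?_⟩
    have hwv : w ≠ v := by
      rintro rfl
      simp [hv] at hw
    exact h w (by simpa [Function.update_apply, hwv] using hw)
  · rintro ⟨hb, h⟩ w
    rw [Function.update_apply]
    split_ifs
    · simpa using Ne.symm hb
    · exact h w

lemma card_uncolored_update (hv : f v = none) :
    (uncolored (Function.update f v (some a))).card + 1 = (uncolored f).card := by
  rw [uncolored_update, Finset.card_erase_add_one (mem_uncolored.2 hv)]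

lemma card_update_of_untouched (hv : v.1 ∈ untouched f) (h : legalColor (K k r) f v a) :
    (untouched (Function.update f v (some a))).card + 1 = (untouched f).card ∧
    (freeColors (Function.update f v (some a))).card + 1 = (freeColors f).card ∧
    (pending (Function.update f v (some a))).card + 1 = (pending f).card + r v.1 := by
  have hn : f v = none := mem_untouched.1 hv v.2
  refine ⟨?_, ?_, ?_⟩
  · rw [untouched_update, Finset.card_erase_add_one hv]
  · rw [freeColors_update hn, Finset.card_erase_add_one (mem_freeColors_of_legalColor hv h)]
  · have h1 := card_pending_add_sum (f := f)
    have h2 := card_pending_add_sum (f := Function.update f v (some a))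
    have h3 := card_uncolored_update (a := a) hn
    rw [untouched_update] at h2
    have h4 := Finset.sum_erase_add _ r hv
    omega

lemma card_update_of_touched (hn : f v = none) (hv : v.1 ∉ untouched f) :
    (untouched (Function.update f v (some a))).card = (untouched f).card ∧
    (pending (Function.update f v (some a))).card + 1 = (pending f).card := by
  have h1 := card_pending_add_sum (f := f)
  have h2 := card_pending_add_sum (f := Function.update f v (some a))
  have h3 := card_uncolored_update (a := a) hn
  rw [untouched_update, Finset.erase_eq_of_notMem hv] at h2
  rw [untouched_update, Finset.erase_eq_of_notMem hv]
  omega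

lemma IsProper.update (hf : IsProper f) (h : legalColor (K k r) f v a) :
    IsProper (Function.update f v (some a)) := by
  rw [legalColor_iff] at h
  intro u w b hu hw
  rw [Function.update_apply] at hu hw
  split_ifs at hu hw with h1 h2 h2
  · rw [h1, h2]
  · cases hu
    rw [h1]
    exact h w hw
  · cases hw
    rw [h2]
    exact (h u hu).symm
  · exact hf u w b hu hw

end Update

/-- The effect of a move on the number of untouched parts, free colors and pending vertices. -/
lemma card_of_gameMove (h : gameMove (K k r) f f') :
    (uncolored f').card + 1 = (uncolored f).card ∧
    (freeColors f').card ≤ (freeColors f).card ∧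
    (freeColors f).card ≤ (freeColors f').card + 1 ∧
    (((untouched f').card + 1 = (untouched f).card ∧
        (freeColors f').card + 1 = (freeColors f).card ∧
        ∃ i, (pending f').card + 1 = (pending f).card + r i) ∨
      ((untouched f').card = (untouched f).card ∧
        (pending f').card + 1 = (pending f).card)) := by
  obtain ⟨v, a, hn, hl, rfl⟩ := h
  refine ⟨card_uncolored_update hn, ?_, ?_, ?_⟩
  · rw [freeColors_update hn]
    exact Finset.card_le_card (Finset.erase_subset _ _)
  · rw [freeColors_update hn]
    exact Nat.le_succ_of_pred_le Finset.pred_card_le_card_erase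
  · by_cases hv : v.1 ∈ untouched f
    · obtain ⟨h1, h2, h3⟩ := card_update_of_untouched hv hl
      exact Or.inl ⟨h1, h2, _, h3⟩
    · exact Or.inr (card_update_of_touched hn hv)

lemma IsProper.gameMove (hf : IsProper f) (h : gameMove (K k r) f f') : IsProper f' := by
  obtain ⟨v, a, -, hl, rfl⟩ := h
  exact hf.update hl

/-- A free color may be played in an untouched part. -/
lemma exists_gameMove_touch {i : Fin k} (hi : i ∈ untouched f) (hr : 0 < r i)
    (hc : 0 < (freeColors f).card) :
    ∃ f', gameMove (K k r) f f' ∧ (untouched f').card + 1 = (untouched f).card ∧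
      (freeColors f').card + 1 = (freeColors f).card ∧
      (pending f').card + 1 = (pending f).card + r i := by
  obtain ⟨a, ha⟩ := Finset.card_pos.1 hc
  have hl := legalColor_of_mem_freeColors (v := ⟨i, ⟨0, hr⟩⟩) ha
  exact ⟨_, ⟨⟨i, ⟨0, hr⟩⟩, a, mem_untouched.1 hi _, hl, rfl⟩, card_update_of_untouched hi hl⟩

/-- A free color may be played at a pending vertex. -/
lemma exists_gameMove_waste (hp : 0 < (pending f).card) (hc : 0 < (freeColors f).card) :
    ∃ f', gameMove (K k r) f f' ∧ (untouched f').card = (untouched f).card ∧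
      (freeColors f').card + 1 = (freeColors f).card ∧
      (pending f').card + 1 = (pending f).card := by
  obtain ⟨a, ha⟩ := Finset.card_pos.1 hc
  obtain ⟨v, hv⟩ := Finset.card_pos.1 hp
  rw [mem_pending] at hv
  obtain ⟨h1, h2⟩ := card_update_of_touched (a := a) hv.1 hv.2
  refine ⟨_, ⟨v, a, hv.1, legalColor_of_mem_freeColors ha, rfl⟩, h1, ?_, h2⟩
  rw [freeColors_update hv.1, Finset.card_erase_add_one ha]

lemma IsProper.exists_legalColor (hf : IsProper f) {v : Σ i : Fin k, Fin (r i)}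
    (hv : v.1 ∉ untouched f) : ∃ a, a ∉ freeColors f ∧ legalColor (K k r) f v a := by
  rw [mem_untouched] at hv
  push Not at hv
  obtain ⟨x, hx⟩ := hv
  obtain ⟨a, ha⟩ := Option.ne_none_iff_exists'.1 hx
  refine ⟨a, fun h => mem_freeColors.1 h _ ha, legalColor_iff.2 fun w hw => ?_⟩
  exact hf ⟨v.1, x⟩ w a ha hw

/-- A color of its own part may be played at a pending vertex. -/
lemma IsProper.exists_gameMove_reuse (hf : IsProper f) (hp : 0 < (pending f).card) :
    ∃ f', _root_.gameMove (K k r) f f' ∧ (untouched f').card = (untouched f).card ∧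
      (freeColors f').card = (freeColors f).card ∧
      (pending f').card + 1 = (pending f).card := by
  obtain ⟨v, hv⟩ := Finset.card_pos.1 hp
  rw [mem_pending] at hv
  obtain ⟨a, ha, hl⟩ := hf.exists_legalColor hv.2
  obtain ⟨h1, h2⟩ := card_update_of_touched (a := a) hv.1 hv.2
  refine ⟨_, ⟨v, a, hv.1, hl, rfl⟩, h1, ?_, h2⟩
  rw [freeColors_update hv.1, Finset.erase_eq_of_notMem ha]

lemma isStuck_of_card_freeColors (hr : ∀ i, 0 < r i) (hU : 0 < (untouched f).card)
    (hc : (freeColors f).card = 0) : isStuck (K k r) f := by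
  obtain ⟨i, hi⟩ := Finset.card_pos.1 hU
  refine ⟨⟨i, ⟨0, hr i⟩⟩, mem_untouched.1 hi _, fun a ha => ?_⟩
  have := mem_freeColors_of_legalColor hi ha
  rw [Finset.card_eq_zero.1 hc] at this
  simp at this

lemma IsProper.not_isStuck (hf : IsProper f)
    (h : 0 < (untouched f).card → 0 < (freeColors f).card) : ¬ isStuck (K k r) f := by
  rintro ⟨v, -, hs⟩
  by_cases hv : v.1 ∈ untouched f
  · obtain ⟨a, ha⟩ := Finset.card_pos.1 (h (Finset.card_pos.2 ⟨_, hv⟩))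
    exact hs a (legalColor_of_mem_freeColors ha)
  · obtain ⟨a, -, ha⟩ := hf.exists_legalColor hv
    exact hs a ha

lemma isFull_iff : isFull f ↔ (uncolored f).card = 0 := by
  simp [isFull, Finset.card_eq_zero, Finset.eq_empty_iff_forall_notMem, mem_uncolored,
    Option.isSome_iff_ne_none]

lemma not_isFull (hr : ∀ i, 0 < r i) (hU : 0 < (untouched f).card) : ¬ isFull f := by
  obtain ⟨i, hi⟩ := Finset.card_pos.1 hU
  intro h
  simpa [mem_untouched.1 hi ⟨0, hr i⟩] using h ⟨i, ⟨0, hr i⟩⟩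

lemma aliceTurn_iff (heven : Even (∑ i, r i)) : aliceTurn f ↔ Even (uncolored f).card := by
  classical
  have h := Finset.card_filter_add_card_filter_not
    (s := (Finset.univ : Finset (Σ i : Fin k, Fin (r i)))) (fun v => (f v).isSome = true)
  have h2 : Finset.univ.filter (fun v => ¬ (f v).isSome = true) = uncolored f := by
    ext v
    simp [mem_uncolored]
  rw [h2] at h
  have hcard : (Finset.univ : Finset (Σ i : Fin k, Fin (r i))).card = ∑ i, r i := by simp
  rw [← hcard, ← h, Nat.even_add] at heven
  exact heven

lemma aliceTurn_gameMove (h : gameMove (K k r) f f') : aliceTurn f' ↔ ¬ aliceTurn f := by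
  obtain ⟨v, a, hn, -, rfl⟩ := h
  have h2 : Finset.univ.filter (fun w => (Function.update f v (some a) w).isSome = true)
      = insert v (Finset.univ.filter fun w => (f w).isSome = true) := by
    ext w
    by_cases hw : w = v <;> simp [Function.update_apply, hw]
  rw [aliceTurn, aliceTurn, h2, Finset.card_insert_of_notMem (by simp [hn]), Nat.even_add_one]

/-- Positions with Alice to move from which Bob wins. -/
def BobWinsAliceToMove (f : (Σ i : Fin k, Fin (r i)) → Option (Fin m)) : Prop :=
  (freeColors f).card + 3 ≤ 2 * (untouched f).card ∨
    (freeColors f).card + 2 ≤ 2 * (untouched f).card ∧ 2 ≤ (pending f).card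

/-- Positions with Bob to move from which Bob wins. -/
def BobWinsBobToMove (f : (Σ i : Fin k, Fin (r i)) → Option (Fin m)) : Prop :=
  (freeColors f).card + 3 ≤ 2 * (untouched f).card ∨
    (freeColors f).card + 2 ≤ 2 * (untouched f).card ∧ 1 ≤ (pending f).card ∨
    (freeColors f).card + 1 ≤ 2 * (untouched f).card ∧ 3 ≤ (pending f).card

lemma BobWinsAliceToMove.gameMove (hr : ∀ i, 2 ≤ r i) (hf : BobWinsAliceToMove f)
    (h : gameMove (K k r) f f') : BobWinsBobToMove f' := by
  obtain ⟨-, h1, h2, ⟨h3, h4, i, h5⟩ | ⟨h3, h4⟩⟩ := card_of_gameMove h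
  · have := hr i
    unfold BobWinsAliceToMove at hf
    unfold BobWinsBobToMove
    omega
  · unfold BobWinsAliceToMove at hf
    unfold BobWinsBobToMove
    omega

lemma exists_odd_untouched (hodd : Odd (uncolored f).card) (hp : (pending f).card = 0) :
    ∃ i ∈ untouched f, Odd (r i) := by
  by_contra! h
  have h1 := card_pending_add_sum (f := f)
  rw [hp, zero_add] at h1
  rw [← h1] at hodd
  exact Nat.not_even_iff_odd.2 hodd
    (Finset.even_sum _ fun i hi => Nat.not_odd_iff_even.1 (h i hi))

lemma BobWinsBobToMove.exists_gameMove (hr : ∀ i, 2 ≤ r i) (hf : BobWinsBobToMove f)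
    (hodd : Odd (uncolored f).card) (hc : 0 < (freeColors f).card) :
    ∃ f', _root_.gameMove (K k r) f f' ∧ BobWinsAliceToMove f' := by
  rcases Nat.eq_zero_or_pos (pending f).card with hp | hp
  · obtain ⟨i, hi, ho⟩ := exists_odd_untouched hodd hp
    have hi2 : 3 ≤ r i := by
      have := hr i
      obtain ⟨t, ht⟩ := ho
      omega
    obtain ⟨f', h, h1, h2, h3⟩ := exists_gameMove_touch hi (by omega) hc
    refine ⟨f', h, ?_⟩
    unfold BobWinsBobToMove at hf
    unfold BobWinsAliceToMove
    omega
  · obtain ⟨f', h, h1, h2, h3⟩ := exists_gameMove_waste hp hc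
    refine ⟨f', h, ?_⟩
    unfold BobWinsBobToMove at hf
    unfold BobWinsAliceToMove
    omega

lemma not_aliceWinsFrom (hr : ∀ i, 2 ≤ r i) (heven : Even (∑ i, r i)) (n : ℕ) :
    ∀ f : (Σ i : Fin k, Fin (r i)) → Option (Fin m),
      (aliceTurn f → BobWinsAliceToMove f) → (¬ aliceTurn f → BobWinsBobToMove f) →
      ¬ aliceWinsFrom (K k r) n f := by
  have hr' : ∀ i, 0 < r i := fun i => by have := hr i; omega
  induction n with
  | zero =>
    intro f hA hB h
    have hU : 0 < (untouched f).card := by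
      by_cases ht : aliceTurn f
      · have := hA ht
        unfold BobWinsAliceToMove at this
        omega
      · have := hB ht
        unfold BobWinsBobToMove at this
        omega
    exact not_isFull hr' hU h
  | succ n ih =>
    intro f hA hB h
    have hU : 0 < (untouched f).card := by
      by_cases ht : aliceTurn f
      · have := hA ht
        unfold BobWinsAliceToMove at this
        omega
      · have := hB ht
        unfold BobWinsBobToMove at this
        omega
    rcases h with h | ⟨hs, ⟨ht, f', hm, hw⟩ | ⟨ht, hw⟩⟩
    · exact not_isFull hr' hU h
    · have ht' := aliceTurn_gameMove hm
      exact ih f' (fun h => absurd ht (ht'.1 h)) (fun _ => (hA ht).gameMove hr hm) hw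
    · have hc : 0 < (freeColors f).card := by
        by_contra hc
        exact hs (isStuck_of_card_freeColors hr' hU (by omega))
      have hodd : Odd (uncolored f).card := by
        rwa [aliceTurn_iff heven, Nat.not_even_iff_odd] at ht
      obtain ⟨g, hm, hg⟩ := (hB ht).exists_gameMove hr hodd hc
      have htg := aliceTurn_gameMove hm
      exact ih g (fun _ => hg) (fun h => absurd (htg.2 ht) h) (hw g hm)

/-- Positions with Alice to move from which Alice wins. -/
def AliceWinsAliceToMove (f : (Σ i : Fin k, Fin (r i)) → Option (Fin m)) : Prop :=
  2 * (untouched f).card ≤ (freeColors f).card + 1 ∨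
    2 * (untouched f).card ≤ (freeColors f).card + 2 ∧ (pending f).card = 1 ∧
      1 ≤ (freeColors f).card

/-- Positions with Bob to move from which Alice wins. -/
def AliceWinsBobToMove (f : (Σ i : Fin k, Fin (r i)) → Option (Fin m)) : Prop :=
  2 * (untouched f).card ≤ (freeColors f).card ∨
    2 * (untouched f).card ≤ (freeColors f).card + 2 ∧ (pending f).card = 0 ∧
      1 ≤ (freeColors f).card ∨
    2 * (untouched f).card ≤ (freeColors f).card + 1 ∧ (pending f).card = 2 ∧
      2 ≤ (freeColors f).card

lemma AliceWinsBobToMove.gameMove (hf : AliceWinsBobToMove f)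
    (h : gameMove (K k r) f f') : AliceWinsAliceToMove f' := by
  obtain ⟨-, h1, h2, ⟨h3, h4, i, h5⟩ | ⟨h3, h4⟩⟩ := card_of_gameMove h
  · unfold AliceWinsBobToMove at hf
    unfold AliceWinsAliceToMove
    omega
  · unfold AliceWinsBobToMove at hf
    unfold AliceWinsAliceToMove
    omega

lemma AliceWinsAliceToMove.exists_gameMove (hr : ∀ i, 0 < r i) (hp : IsProper f)
    (hf : AliceWinsAliceToMove f) (hn : 0 < (uncolored f).card) :
    ∃ f', _root_.gameMove (K k r) f f' ∧ AliceWinsBobToMove f' := by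
  by_cases h : 2 * (untouched f).card ≤ (freeColors f).card + 1 ∧ 0 < (untouched f).card
  · obtain ⟨i, hi⟩ := Finset.card_pos.1 h.2
    obtain ⟨f', hm, h1, h2, h3⟩ := exists_gameMove_touch hi (hr i) (by omega)
    refine ⟨f', hm, ?_⟩
    unfold AliceWinsBobToMove
    omega
  · have hpos : 0 < (pending f).card := by
      by_contra hq
      have hU : (untouched f).card = 0 := by
        unfold AliceWinsAliceToMove at hf
        omega
      have h1 := card_pending_add_sum (f := f)
      rw [Finset.card_eq_zero.1 hU, Finset.sum_empty] at h1
      omega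
    obtain ⟨f', hm, h1, h2, h3⟩ := hp.exists_gameMove_reuse hpos
    refine ⟨f', hm, ?_⟩
    unfold AliceWinsAliceToMove at hf
    unfold AliceWinsBobToMove
    omega

lemma aliceWinsFrom_of_card (hr : ∀ i, 0 < r i) (n : ℕ) :
    ∀ f : (Σ i : Fin k, Fin (r i)) → Option (Fin m), IsProper f → (uncolored f).card = n →
      (aliceTurn f → AliceWinsAliceToMove f) → (¬ aliceTurn f → AliceWinsBobToMove f) →
      aliceWinsFrom (K k r) n f := by
  induction n with
  | zero => exact fun f _ hn _ _ => isFull_iff.2 hn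
  | succ n ih =>
    intro f hp hn hA hB
    refine Or.inr ⟨hp.not_isStuck fun hU => ?_, ?_⟩
    · by_cases ht : aliceTurn f
      · have := hA ht
        unfold AliceWinsAliceToMove at this
        omega
      · have := hB ht
        unfold AliceWinsBobToMove at this
        omega
    · by_cases ht : aliceTurn f
      · obtain ⟨f', hm, hf'⟩ := (hA ht).exists_gameMove hr hp (by omega)
        have ht' := aliceTurn_gameMove hm
        have := (card_of_gameMove hm).1
        exact Or.inl ⟨ht, f', hm, ih f' (hp.gameMove hm) (by omega)
          (fun h => absurd ht (ht'.1 h)) fun _ => hf'⟩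
      · refine Or.inr ⟨ht, fun f' hm => ?_⟩
        have ht' := aliceTurn_gameMove hm
        have := (card_of_gameMove hm).1
        exact ih f' (hp.gameMove hm) (by omega) (fun _ => (hB ht).gameMove hm)
          fun h => absurd (ht'.2 ht) h

section Initial

lemma untouched_none :
    untouched (fun _ => none : (Σ i : Fin k, Fin (r i)) → Option (Fin m)) = Finset.univ := by
  ext
  simp [mem_untouched]

lemma freeColors_none :
    freeColors (fun _ => none : (Σ i : Fin k, Fin (r i)) → Option (Fin m)) = Finset.univ := by
  ext
  simp [mem_freeColors]

lemma uncolored_none :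
    uncolored (fun _ => none : (Σ i : Fin k, Fin (r i)) → Option (Fin m)) = Finset.univ := by
  ext
  simp [mem_uncolored]

lemma pending_none :
    pending (fun _ => none : (Σ i : Fin k, Fin (r i)) → Option (Fin m)) = ∅ := by
  ext
  simp [mem_pending, untouched_none]

lemma aliceTurn_none :
    aliceTurn (fun _ => none : (Σ i : Fin k, Fin (r i)) → Option (Fin m)) := by
  simp [aliceTurn]

end Initial

lemma not_aliceWins (hr : ∀ i, 2 ≤ r i) (heven : Even (∑ i, r i)) (hm : m + 3 ≤ 2 * k) :
    ¬ aliceWins (K k r) m := by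
  refine not_aliceWinsFrom hr heven _ _ (fun _ => Or.inl ?_) fun h => absurd aliceTurn_none h
  simpa [freeColors_none, untouched_none] using hm

lemma aliceWins_of_exists_three (hk : 3 ≤ k) (hr : ∀ i, 0 < r i) (h3 : ∃ j, r j = 3) :
    aliceWins (K k r) (2 * k - 2) := by
  obtain ⟨j, hj⟩ := h3
  let f₀ : (Σ i : Fin k, Fin (r i)) → Option (Fin (2 * k - 2)) := fun _ => none
  have hp : IsProper f₀ := fun v w a h => by simp [f₀] at h
  have hC : (freeColors f₀).card = 2 * k - 2 := by simp [f₀, freeColors_none]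
  have hU : (untouched f₀).card = k := by simp [f₀, untouched_none]
  have hP : (pending f₀).card = 0 := by simp [f₀, pending_none]
  have hN : (uncolored f₀).card = Fintype.card (Σ i : Fin k, Fin (r i)) := by
    simp only [f₀, uncolored_none, Finset.card_univ]
  obtain ⟨f', hm, h1, h2, h4⟩ :=
    exists_gameMove_touch (f := f₀) (i := j) (by simp [f₀, untouched_none]) (hr j) (by omega)
  have hturn : aliceTurn f₀ := aliceTurn_none
  have ht' := aliceTurn_gameMove hm
  have hcard := (card_of_gameMove hm).1
  unfold aliceWins
  change aliceWinsFrom _ _ f₀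
  rw [← hN, ← hcard]
  refine Or.inr ⟨hp.not_isStuck fun _ => by omega, Or.inl ⟨hturn, f', hm, ?_⟩⟩
  refine aliceWinsFrom_of_card hr _ f' (hp.gameMove hm) rfl
    (fun h => absurd hturn (ht'.1 h)) fun _ => ?_
  unfold AliceWinsBobToMove
  omega

end ColoringGame

theorem game_chromatic_eq_of_min_two_three_even (k : ℕ) (hk : 3 ≤ k) (r : Fin k → ℕ)
    (hanti : Antitone r) (hlast : r ⟨k - 1, by omega⟩ = 2) (h3 : ∃ j, r j = 3)
    (heven : Even (∑ i, r i)) :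
    gameChromaticNumber (K k r) = 2 * k - 2 := by
  have hr : ∀ i, 2 ≤ r i := fun i => by
    rw [← hlast]
    exact hanti (Fin.mk_le_mk.2 (by omega) : i ≤ ⟨k - 1, by omega⟩)
  have hwin := ColoringGame.aliceWins_of_exists_three hk (fun i => by have := hr i; omega) h3
  refine le_antisymm (Nat.sInf_le hwin) (le_csInf ⟨_, hwin⟩ fun m hm => ?_)
  by_contra hlt
  exact ColoringGame.not_aliceWins hr heven (by omega) hm
end
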